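/- arXiv:1511.01149 — 5 statements merged into one kernel-verified Lean document; each statement's English description precedes it below -/
import Mathlib

section
/- Let μ ∈ (0,2) and let V_μ = {(r cos θ, r sin θ) : 0 < r < ∞, 0 < θ < μπ} be the open infinite cone of opening angle μπ in ℝ². The function v_μ defined in polar coordinates by v_μ(r, θ) = −log( μ r sin(θ/μ) ) is smooth on V_μ, satisfies Liouville's equation Δv_μ = e^{2v_μ} in V_μ, and v_μ(z) → +∞ as z → p from within V_μ for every boundary point p ∈ ∂V_μ with p ≠ 0. -/
/-- The Laplacian of a function on `ℂ ≅ ℝ²`: sum of the second directional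
derivatives in the two coordinate directions `1` and `I`. -/
noncomputable def lap (u : ℂ → ℝ) (z : ℂ) : ℝ :=
  fderiv ℝ (fun w => fderiv ℝ u w 1) z 1 +
  fderiv ℝ (fun w => fderiv ℝ u w Complex.I) z Complex.I

/-- The polar angle of a nonzero complex number, normalized to lie in `(0, 2π]`. -/
noncomputable def polarAngle (z : ℂ) : ℝ :=
  if 0 < Complex.arg z then Complex.arg z else Complex.arg z + 2 * Real.pi

/-- The open infinite cone `V_μ = {(r cos θ, r sin θ) : 0 < r, 0 < θ < μπ}` in `ℂ ≅ ℝ²`. -/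
def cone (μ : ℝ) : Set ℂ :=
  {z | ∃ r θ : ℝ, 0 < r ∧ 0 < θ ∧ θ < μ * Real.pi ∧
    z = (r : ℂ) * Complex.exp ((θ : ℂ) * Complex.I)}

/-- On the plane slit along `[0, ∞)` the polar angle is a shifted branch of the argument. -/
theorem polarAngle_eq_log_neg_im {z : ℂ} (hz : -z ∈ Complex.slitPlane) :
    polarAngle z = (Complex.log (-z)).im + Real.pi := by
  have hpi := Real.pi_pos
  rw [Complex.log_im, polarAngle]
  rcases lt_trichotomy z.im 0 with h | h | h
  · have h1 := Complex.arg_neg_iff.2 h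
    rw [if_neg h1.le.not_gt, Complex.arg_neg_eq_arg_add_pi_of_im_neg h]
    ring
  · have hre : z.re < 0 := by
      rcases Complex.mem_slitPlane_iff.1 hz with h' | h'
      · simpa using h'
      · simp [h] at h'
    have h1 : Complex.arg z = Real.pi := Complex.arg_eq_pi_iff.2 ⟨hre, h⟩
    have h2 : Complex.arg (-z) = 0 :=
      Complex.arg_eq_zero_iff.2 ⟨by simpa using hre.le, by simpa using h⟩
    rw [h1, h2, if_pos hpi, zero_add]
  · have h1 : 0 < Complex.arg z := by
      refine lt_of_le_of_ne (Complex.arg_nonneg_iff.2 h.le) fun h0 => ?_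
      exact h.ne' (Complex.arg_eq_zero_iff.1 h0.symm).2
    rw [if_pos h1, Complex.arg_neg_eq_arg_sub_pi_of_im_pos h]
    ring

theorem mem_cone_iff {μ : ℝ} (hμ2 : μ < 2) {z : ℂ} :
    z ∈ cone μ ↔ -z ∈ Complex.slitPlane ∧ polarAngle z < μ * Real.pi := by
  have hpi := Real.pi_pos
  constructor
  · rintro ⟨r, θ, hr, h0, h1, rfl⟩
    have h2 : θ < 2 * Real.pi := h1.trans (by nlinarith)
    have hneg : -((r : ℂ) * Complex.exp ((θ : ℂ) * Complex.I)) =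
        (r : ℂ) * Complex.exp (((θ - Real.pi : ℝ) : ℂ) * Complex.I) := by
      rw [Complex.ofReal_sub, sub_mul, Complex.exp_sub, Complex.exp_pi_mul_I]
      ring
    have harg : Complex.arg (-((r : ℂ) * Complex.exp ((θ : ℂ) * Complex.I))) =
        θ - Real.pi := by
      rw [hneg, Complex.arg_real_mul _ hr, Complex.arg_exp_mul_I, toIocMod_eq_self]
      constructor <;> linarith
    have hs : -((r : ℂ) * Complex.exp ((θ : ℂ) * Complex.I)) ∈ Complex.slitPlane := by
      rw [Complex.mem_slitPlane_iff_arg, harg]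
      refine ⟨by linarith, ?_⟩
      simp [hr.ne']
    refine ⟨hs, ?_⟩
    rw [polarAngle_eq_log_neg_im hs, Complex.log_im, harg]
    linarith
  · rintro ⟨hs, h1⟩
    have hz : z ≠ 0 := neg_ne_zero.1 (Complex.slitPlane_ne_zero hs)
    refine ⟨‖z‖, polarAngle z, norm_pos_iff.2 hz, ?_, h1, ?_⟩
    · rw [polarAngle_eq_log_neg_im hs, Complex.log_im]
      linarith [Complex.neg_pi_lt_arg (-z)]
    · rw [polarAngle_eq_log_neg_im hs, Complex.log_im, Complex.ofReal_add, add_mul,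
        Complex.exp_add, Complex.exp_pi_mul_I, ← mul_assoc, ← norm_neg z,
        Complex.norm_mul_exp_arg_mul_I]
      ring

theorem sin_polarAngle_div_pos {μ : ℝ} (hμ0 : 0 < μ) (hμ2 : μ < 2) {z : ℂ} (hz : z ∈ cone μ) :
    0 < Real.sin (polarAngle z / μ) := by
  obtain ⟨hs, h1⟩ := (mem_cone_iff hμ2).1 hz
  have h0 : 0 < polarAngle z := by
    rw [polarAngle_eq_log_neg_im hs, Complex.log_im]
    linarith [Complex.neg_pi_lt_arg (-z)]
  exact Real.sin_pos_of_pos_of_lt_pi (div_pos h0 hμ0) ((div_lt_iff₀' hμ0).2 h1)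

theorem hasFDerivAt_log_neg {z : ℂ} (hz : -z ∈ Complex.slitPlane) :
    HasFDerivAt (𝕜 := ℝ) (fun w => Complex.log (-w))
      (z⁻¹ • (1 : ℂ →L[ℝ] ℂ)) z := by
  have h := ((hasDerivAt_neg z).clog hz).complexToReal_fderiv
  convert h using 2
  have hz0 : z ≠ 0 := neg_ne_zero.1 (Complex.slitPlane_ne_zero hz)
  field_simp

open Topology in
theorem polarAngle_eventuallyEq {z : ℂ} (hz : -z ∈ Complex.slitPlane) :
    polarAngle =ᶠ[𝓝 z] fun w => (Complex.log (-w)).im + Real.pi := by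
  filter_upwards [(Complex.isOpen_slitPlane.preimage continuous_neg).mem_nhds hz] with w hw
  exact polarAngle_eq_log_neg_im hw

theorem hasFDerivAt_polarAngle {z : ℂ} (hz : -z ∈ Complex.slitPlane) :
    HasFDerivAt polarAngle (Complex.imCLM.comp (z⁻¹ • (1 : ℂ →L[ℝ] ℂ))) z :=
  ((Complex.imCLM.hasFDerivAt.comp z (hasFDerivAt_log_neg hz)).add_const
    Real.pi).congr_of_eventuallyEq (polarAngle_eventuallyEq hz)

theorem contDiffAt_polarAngle {z : ℂ} (hz : -z ∈ Complex.slitPlane) {n : WithTop ℕ∞} :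
    ContDiffAt ℝ n polarAngle z := by
  refine ContDiffAt.congr_of_eventuallyEq ?_ (polarAngle_eventuallyEq hz)
  have h : ContDiffAt ℝ n (fun w : ℂ => Complex.log (-w)) z :=
    ((Complex.contDiffAt_log hz).comp z contDiff_neg.contDiffAt).restrict_scalars ℝ
  exact (Complex.imCLM.contDiff.contDiffAt.comp z h).add contDiffAt_const

theorem isOpen_cone {μ : ℝ} (hμ2 : μ < 2) : IsOpen (cone μ) := by
  rw [isOpen_iff_mem_nhds]
  intro z hz
  obtain ⟨hs, h1⟩ := (mem_cone_iff hμ2).1 hz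
  filter_upwards [(Complex.isOpen_slitPlane.preimage continuous_neg).mem_nhds hs,
    (hasFDerivAt_polarAngle hs).continuousAt.eventually_lt_const h1] with w hw hw1
  exact (mem_cone_iff hμ2).2 ⟨hw, hw1⟩

theorem hasFDerivAt_log_norm {z : ℂ} (hz : -z ∈ Complex.slitPlane) :
    HasFDerivAt (fun w : ℂ => Real.log ‖w‖) (Complex.reCLM.comp (z⁻¹ • (1 : ℂ →L[ℝ] ℂ))) z := by
  refine (Complex.reCLM.hasFDerivAt.comp z (hasFDerivAt_log_neg hz)).congr_of_eventuallyEq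
    (Filter.Eventually.of_forall fun w => ?_)
  simp [Complex.log_re]

section LiouvilleSolution

variable {μ : ℝ} {v : ℂ → ℝ}

theorem fderiv_liouvilleSolution_apply (hμ0 : 0 < μ) (hμ2 : μ < 2)
    (hv : ∀ z : ℂ, v z = -Real.log (μ * ‖z‖ * Real.sin (polarAngle z / μ)))
    {z : ℂ} (hz : z ∈ cone μ) (h : ℂ) :
    fderiv ℝ v z h = -(z⁻¹ * h).re -
      Real.cos (polarAngle z / μ) / Real.sin (polarAngle z / μ) * ((z⁻¹ * h).im / μ) := by
  obtain ⟨hs, -⟩ := (mem_cone_iff hμ2).1 hz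
  have hsin := sin_polarAngle_div_pos hμ0 hμ2 hz
  have hev : v =ᶠ[nhds z] fun w => -(Real.log μ + Real.log ‖w‖ +
      Real.log (Real.sin (polarAngle w * μ⁻¹))) := by
    filter_upwards [(isOpen_cone hμ2).mem_nhds hz] with w hw
    have hw0 : w ≠ 0 := neg_ne_zero.1 (Complex.slitPlane_ne_zero ((mem_cone_iff hμ2).1 hw).1)
    rw [hv, Real.log_mul (by positivity) (sin_polarAngle_div_pos hμ0 hμ2 hw).ne',
      Real.log_mul hμ0.ne' (by positivity), div_eq_mul_inv]
  have hd := (((hasFDerivAt_log_norm hs).const_add (Real.log μ)).add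
    ((((hasFDerivAt_polarAngle hs).mul_const μ⁻¹).sin).log
      (by rw [← div_eq_mul_inv]; exact hsin.ne'))).neg
  rw [(hd.congr_of_eventuallyEq hev).fderiv]
  simp
  field_simp
  ring

theorem fderiv_fderiv_liouvilleSolution_apply (hμ0 : 0 < μ) (hμ2 : μ < 2)
    (hv : ∀ z : ℂ, v z = -Real.log (μ * ‖z‖ * Real.sin (polarAngle z / μ)))
    {z : ℂ} (hz : z ∈ cone μ) (h : ℂ) :
    fderiv ℝ (fun w => fderiv ℝ v w h) z h = ((z⁻¹ * h) ^ 2).re +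
      Real.cos (polarAngle z / μ) / Real.sin (polarAngle z / μ) * (((z⁻¹ * h) ^ 2).im / μ) +
      ((z⁻¹ * h).im / μ) ^ 2 / Real.sin (polarAngle z / μ) ^ 2 := by
  obtain ⟨hs, -⟩ := (mem_cone_iff hμ2).1 hz
  have hz0 : z ≠ 0 := neg_ne_zero.1 (Complex.slitPlane_ne_zero hs)
  have hsin := sin_polarAngle_div_pos hμ0 hμ2 hz
  have hev : (fun w => fderiv ℝ v w h) =ᶠ[nhds z] fun w => -(w⁻¹ * h).re -
      Real.cos (polarAngle w * μ⁻¹) * (Real.sin (polarAngle w * μ⁻¹))⁻¹ *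
        ((w⁻¹ * h).im * μ⁻¹) := by
    filter_upwards [(isOpen_cone hμ2).mem_nhds hz] with w hw
    simp only [fderiv_liouvilleSolution_apply hμ0 hμ2 hv hw, div_eq_mul_inv]
  have hinv := ((hasDerivAt_inv hz0).mul_const h).complexToReal_fderiv
  have hre := Complex.reCLM.hasFDerivAt.comp z hinv
  have him := Complex.imCLM.hasFDerivAt.comp z hinv
  have hang := (hasFDerivAt_polarAngle hs).mul_const μ⁻¹
  have hsin' : Real.sin (polarAngle z * μ⁻¹) ≠ 0 := by
    rw [← div_eq_mul_inv]; exact hsin.ne'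
  have hsinv := (hasDerivAt_inv hsin').comp_hasFDerivAt z hang.sin
  have hd := hre.neg.sub ((hang.cos.mul hsinv).mul (him.mul_const μ⁻¹))
  rw [(hd.congr_of_eventuallyEq hev).fderiv]
  have hsq : (z ^ 2)⁻¹ * h * h = (z⁻¹ * h) ^ 2 := by ring
  have hcs := Real.sin_sq_add_cos_sq (polarAngle z * μ⁻¹)
  simp [-Complex.mul_re, -Complex.mul_im, -mul_eq_mul_left_iff]
  rw [hsq, div_eq_mul_inv (polarAngle z) μ]
  generalize Real.cos (polarAngle z * μ⁻¹) = c at *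
  generalize Real.sin (polarAngle z * μ⁻¹) = s at *
  generalize ((z⁻¹ * h) ^ 2).re = a
  generalize ((z⁻¹ * h) ^ 2).im = b
  generalize (z⁻¹ * h).im = y
  field_simp
  linear_combination y ^ 2 * hcs

theorem lap_liouvilleSolution (hμ0 : 0 < μ) (hμ2 : μ < 2)
    (hv : ∀ z : ℂ, v z = -Real.log (μ * ‖z‖ * Real.sin (polarAngle z / μ)))
    {z : ℂ} (hz : z ∈ cone μ) : lap v z = Real.exp (2 * v z) := by
  have hz0 : z ≠ 0 := neg_ne_zero.1 (Complex.slitPlane_ne_zero ((mem_cone_iff hμ2).1 hz).1)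
  have hsin := sin_polarAngle_div_pos hμ0 hμ2 hz
  have hpos : 0 < μ * ‖z‖ * Real.sin (polarAngle z / μ) := by positivity
  have hexp : Real.exp (2 * v z) = ((μ * ‖z‖ * Real.sin (polarAngle z / μ)) ^ 2)⁻¹ := by
    rw [hv, mul_comm, Real.exp_mul, Real.exp_neg, Real.exp_log hpos]
    simp only [Real.rpow_ofNat, inv_pow]
  have hnorm : (z⁻¹).re ^ 2 + (z⁻¹).im ^ 2 = (‖z‖ ^ 2)⁻¹ := by
    rw [← inv_pow, ← norm_inv, Complex.sq_norm, Complex.normSq_apply]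
    ring
  have hI : (z⁻¹ * Complex.I) ^ 2 = -(z⁻¹) ^ 2 := by
    rw [mul_pow, Complex.I_sq]
    ring
  rw [lap, fderiv_fderiv_liouvilleSolution_apply hμ0 hμ2 hv hz,
    fderiv_fderiv_liouvilleSolution_apply hμ0 hμ2 hv hz, hexp, hI, mul_one, Complex.neg_re,
    Complex.neg_im, Complex.mul_I_im, mul_pow, mul_pow, mul_inv, mul_inv, ← hnorm]
  field_simp
  ring

theorem contDiffOn_liouvilleSolution (hμ0 : 0 < μ) (hμ2 : μ < 2)
    (hv : ∀ z : ℂ, v z = -Real.log (μ * ‖z‖ * Real.sin (polarAngle z / μ)))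
    {n : WithTop ℕ∞} : ContDiffOn ℝ n v (cone μ) := by
  intro z hz
  obtain ⟨hs, -⟩ := (mem_cone_iff hμ2).1 hz
  have hz0 : z ≠ 0 := neg_ne_zero.1 (Complex.slitPlane_ne_zero hs)
  have hsin := sin_polarAngle_div_pos hμ0 hμ2 hz
  rw [show v = _ from funext hv]
  exact ((((contDiffAt_const.mul (contDiffAt_norm ℝ hz0)).mul
    ((contDiffAt_polarAngle hs).div_const μ).sin).log (by positivity)).neg).contDiffWithinAt

open Filter Topology in
theorem tendsto_liouvilleSolution_atTop (hμ0 : 0 < μ) (hμ2 : μ < 2)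
    (hv : ∀ z : ℂ, v z = -Real.log (μ * ‖z‖ * Real.sin (polarAngle z / μ)))
    {p : ℂ} (hp : p ∈ frontier (cone μ)) (hp0 : p ≠ 0) :
    Tendsto v (𝓝[cone μ] p) atTop := by
  have hpi := Real.pi_pos
  have hpc : p ∉ cone μ := by
    rw [(isOpen_cone hμ2).frontier_eq] at hp
    exact hp.2
  have : (𝓝[cone μ] p).NeBot := mem_closure_iff_nhdsWithin_neBot.1 (frontier_subset_closure hp)
  have hang : ∃ a, Tendsto polarAngle (𝓝[cone μ] p) (𝓝 a) ∧ Real.sin (a / μ) = 0 := by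
    by_cases hs : -p ∈ Complex.slitPlane
    · have ht : Tendsto polarAngle (𝓝[cone μ] p) (𝓝 (polarAngle p)) :=
        (hasFDerivAt_polarAngle hs).continuousAt.continuousWithinAt
      have hle : polarAngle p ≤ μ * Real.pi := le_of_tendsto ht <| by
        filter_upwards [self_mem_nhdsWithin] with w hw
        exact ((mem_cone_iff hμ2).1 hw).2.le
      have hge : μ * Real.pi ≤ polarAngle p :=
        not_lt.1 fun h => hpc ((mem_cone_iff hμ2).2 ⟨hs, h⟩)
      refine ⟨_, ht, ?_⟩
      rw [le_antisymm hle hge, mul_div_cancel_left₀ _ hμ0.ne', Real.sin_pi]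
    · rw [Complex.mem_slitPlane_iff, not_or, not_lt, not_not, Complex.neg_re, Complex.neg_im,
        neg_nonpos, neg_eq_zero] at hs
      have hre : 0 < p.re :=
        lt_of_le_of_ne hs.1 fun h => hp0 (Complex.ext h.symm hs.2)
      have harg : Complex.arg p = 0 := Complex.arg_eq_zero_iff.2 hs
      have ht : Tendsto Complex.arg (𝓝[cone μ] p) (𝓝 0) := by
        rw [← harg]
        exact (Complex.continuousAt_arg (Or.inl hre)).continuousWithinAt
      refine ⟨0, ht.congr' ?_, by simp⟩
      have hlt : μ * Real.pi - 2 * Real.pi < 0 := by nlinarith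
      filter_upwards [self_mem_nhdsWithin, ht.eventually_const_lt hlt] with w hw hw1
      have hw2 := ((mem_cone_iff hμ2).1 hw).2
      rw [polarAngle] at hw2 ⊢
      split_ifs at hw2 ⊢
      · rfl
      · linarith
  obtain ⟨a, ha, hsin⟩ := hang
  have hnorm : Tendsto (fun z : ℂ => ‖z‖) (𝓝[cone μ] p) (𝓝 ‖p‖) :=
    continuous_norm.continuousWithinAt
  have h0 : Tendsto (fun z => μ * ‖z‖ * Real.sin (polarAngle z / μ)) (𝓝[cone μ] p) (𝓝 0) := by
    have h := (hnorm.const_mul μ).mul ((Real.continuous_sin.tendsto _).comp (ha.div_const μ))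
    rwa [hsin, mul_zero] at h
  have h1 : Tendsto (fun z => μ * ‖z‖ * Real.sin (polarAngle z / μ)) (𝓝[cone μ] p)
      (𝓝[>] 0) := by
    refine tendsto_nhdsWithin_iff.2 ⟨h0, ?_⟩
    filter_upwards [self_mem_nhdsWithin] with z hz
    have hz0 : z ≠ 0 := neg_ne_zero.1 (Complex.slitPlane_ne_zero ((mem_cone_iff hμ2).1 hz).1)
    have := sin_polarAngle_div_pos hμ0 hμ2 hz
    exact Set.mem_Ioi.2 (by positivity)
  rw [show v = _ from funext hv]
  exact tendsto_neg_atBot_atTop.comp (Real.tendsto_log_nhdsGT_zero.comp h1)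

end LiouvilleSolution

/-- the explicit solution `v_μ = -log(μ r sin(θ/μ))` of Liouville's equation
in the infinite cone `V_μ` of opening angle `μπ`. -/
theorem liouville_solution_in_cone (μ : ℝ) (hμ0 : 0 < μ) (hμ2 : μ < 2) (v : ℂ → ℝ)
    (hv : ∀ z : ℂ, v z = -Real.log (μ * ‖z‖ * Real.sin (polarAngle z / μ))) :
    ContDiffOn ℝ (⊤ : ℕ∞) v (cone μ) ∧
    (∀ z ∈ cone μ, lap v z = Real.exp (2 * v z)) ∧
    (∀ p ∈ frontier (cone μ), p ≠ 0 →
      Filter.Tendsto v (nhdsWithin p (cone μ)) Filter.atTop) := by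
  exact ⟨contDiffOn_liouvilleSolution hμ0 hμ2 hv,
    fun _ hz => lap_liouvilleSolution hμ0 hμ2 hv hz,
    fun _ hp hp0 => tendsto_liouvilleSolution_atTop hμ0 hμ2 hv hp hp0⟩
end

section
/- (Theorem 2.2, existence) Let Ω ⊂ ℝ² be a bounded domain satisfying a uniform exterior cone condition. Then there exists a function u ∈ C^∞(Ω) satisfying Δu = e^{2u} in Ω and u(z) → +∞ as z → ∂Ω. -/
/-- The real (Euclidean) inner product on `ℂ ≅ ℝ²`. -/
def realInner (a b : ℂ) : ℝ := a.re * b.re + a.im * b.im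

/-- The closed finite cone with vertex `p`, axis direction `e`, height `h`
and half-opening angle `θ₀`. -/
def finiteCone (p e : ℂ) (h θ₀ : ℝ) : Set ℂ :=
  {z | ∃ (t : ℝ) (ω : ℂ), 0 ≤ t ∧ t ≤ h ∧ ‖ω‖ = 1 ∧
    Real.cos θ₀ ≤ realInner ω e ∧ z = p + t • ω}

/-- `Ω` satisfies the uniform exterior cone condition with height `h` and
half-opening angle `θ₀`: every boundary point is the vertex of a closed
finite cone of height `h` and half-angle `θ₀` disjoint from `Ω`. -/
def UnifExtCone (Ω : Set ℂ) (h θ₀ : ℝ) : Prop :=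
  ∀ p ∈ frontier Ω, ∃ e : ℂ, ‖e‖ = 1 ∧ finiteCone p e h θ₀ ∩ Ω = ∅

section

open Complex Metric Set Filter Topology
open scoped ComplexConjugate

/-- The involutive automorphism of the unit disc exchanging `a` and `0`. -/
noncomputable def discInvolution (a ζ : ℂ) : ℂ := (a - ζ) / (1 - conj a * ζ)

namespace discInvolution

variable {a ζ : ℂ}

theorem denom_ne_zero (ha : ‖a‖ < 1) (hζ : ‖ζ‖ < 1) : 1 - conj a * ζ ≠ 0 := by
  intro h
  have h1 : conj a * ζ = 1 := (sub_eq_zero.mp h).symm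
  have h2 : ‖a‖ * ‖ζ‖ = 1 := by simpa using congrArg norm h1
  nlinarith [norm_nonneg a, norm_nonneg ζ]

theorem norm_lt_one (ha : ‖a‖ < 1) (hζ : ‖ζ‖ < 1) : ‖discInvolution a ζ‖ < 1 := by
  have hd := denom_ne_zero ha hζ
  rw [discInvolution, norm_div, div_lt_one (norm_pos_iff.mpr hd)]
  have key : ‖1 - conj a * ζ‖ ^ 2 - ‖a - ζ‖ ^ 2 = (1 - ‖a‖ ^ 2) * (1 - ‖ζ‖ ^ 2) := by
    simp only [← normSq_eq_norm_sq, normSq_apply, sub_re, sub_im, mul_re, mul_im, conj_re,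
      conj_im, one_re, one_im]
    ring
  have h1 : 0 < (1 - ‖a‖ ^ 2) * (1 - ‖ζ‖ ^ 2) := by
    apply mul_pos <;> nlinarith [norm_nonneg a, norm_nonneg ζ]
  exact lt_of_pow_lt_pow_left₀ 2 (norm_nonneg _) (by linarith)

theorem mapsTo (ha : ‖a‖ < 1) : MapsTo (discInvolution a) (ball 0 1) (ball 0 1) := fun ζ hζ => by
  simpa using norm_lt_one ha (by simpa using hζ)

@[simp] theorem apply_zero (a : ℂ) : discInvolution a 0 = a := by simp [discInvolution]

@[simp] theorem apply_self (a : ℂ) : discInvolution a a = 0 := by simp [discInvolution]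

theorem one_sub_conj_mul_self (a : ℂ) : 1 - conj a * a = ((1 - ‖a‖ ^ 2 : ℝ) : ℂ) := by
  rw [mul_comm, mul_conj, normSq_eq_norm_sq]
  push_cast
  rfl

theorem involutive (ha : ‖a‖ < 1) (hζ : ‖ζ‖ < 1) :
    discInvolution a (discInvolution a ζ) = ζ := by
  have hd := denom_ne_zero ha hζ
  have hs := denom_ne_zero ha ha
  have h2 : 1 - conj a * discInvolution a ζ = (1 - conj a * a) / (1 - conj a * ζ) := by
    rw [discInvolution, eq_div_iff hd, sub_mul, mul_assoc, div_mul_cancel₀ _ hd]; ring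
  have h1 : a - discInvolution a ζ = ζ * ((1 - conj a * a) / (1 - conj a * ζ)) := by
    rw [discInvolution, mul_div_assoc', eq_div_iff hd, sub_mul, div_mul_cancel₀ _ hd]; ring
  rw [discInvolution, h1, h2, mul_div_cancel_right₀ _ (div_ne_zero hs hd)]

theorem hasDerivAt (ha : ‖a‖ < 1) (hζ : ‖ζ‖ < 1) :
    HasDerivAt (discInvolution a) (-((1 - ‖a‖ ^ 2 : ℝ) : ℂ) / (1 - conj a * ζ) ^ 2) ζ := by
  have hd := denom_ne_zero ha hζ
  refine (((hasDerivAt_id ζ).const_sub a).div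
    (((hasDerivAt_id ζ).const_mul (conj a)).const_sub 1) hd).congr_deriv ?_
  rw [← one_sub_conj_mul_self]
  simp only [id]
  congr 1
  ring

theorem differentiableOn (ha : ‖a‖ < 1) : DifferentiableOn ℂ (discInvolution a) (ball 0 1) :=
  fun _ hζ => (hasDerivAt ha (by simpa using hζ)).differentiableAt.differentiableWithinAt

theorem norm_deriv_zero (ha : ‖a‖ < 1) : ‖deriv (discInvolution a) 0‖ = 1 - ‖a‖ ^ 2 := by
  rw [(hasDerivAt ha (by simp)).deriv]
  simp only [mul_zero, sub_zero, one_pow, div_one, norm_neg, norm_real, Real.norm_eq_abs]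
  exact abs_of_nonneg (by nlinarith [norm_nonneg a])

theorem norm_deriv_self (ha : ‖a‖ < 1) : ‖deriv (discInvolution a) a‖ = (1 - ‖a‖ ^ 2)⁻¹ := by
  rw [(hasDerivAt ha ha).deriv, one_sub_conj_mul_self]
  have : 0 < 1 - ‖a‖ ^ 2 := by nlinarith [norm_nonneg a]
  rw [norm_div, norm_neg, norm_pow, norm_real, Real.norm_of_nonneg this.le]
  field_simp

end discInvolution

theorem DifferentiableOn.differentiableAt_ball {f : ℂ → ℂ} {c ζ : ℂ} {r : ℝ}
    (hf : DifferentiableOn ℂ f (ball c r)) (hζ : ζ ∈ ball c r) : DifferentiableAt ℂ f ζ :=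
  hf.differentiableAt (isOpen_ball.mem_nhds hζ)

/-- The Schwarz–Pick inequality at the centre of the disc. -/
theorem norm_deriv_zero_le_one_sub_sq {φ : ℂ → ℂ} (hd : DifferentiableOn ℂ φ (ball 0 1))
    (hm : MapsTo φ (ball 0 1) (ball 0 1)) : ‖deriv φ 0‖ ≤ 1 - ‖φ 0‖ ^ 2 := by
  have h0 : (0 : ℂ) ∈ ball (0 : ℂ) 1 := by simp
  have hφ0 : ‖φ 0‖ < 1 := by simpa using hm h0
  have hpos : 0 < 1 - ‖φ 0‖ ^ 2 := by nlinarith [norm_nonneg (φ 0)]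
  have hle : ‖deriv (discInvolution (φ 0) ∘ φ) 0‖ ≤ 1 := by
    refine norm_deriv_le_one_of_mapsTo_ball (R := 1)
      ((discInvolution.differentiableOn hφ0).comp hd hm) ?_ one_pos
    simpa using ((discInvolution.mapsTo hφ0).comp hm).mono_right ball_subset_closedBall
  rw [deriv_comp _ ((discInvolution.differentiableOn hφ0).differentiableAt_ball (hm h0))
    (hd.differentiableAt_ball h0), norm_mul, discInvolution.norm_deriv_self hφ0] at hle
  rwa [inv_mul_le_iff₀ hpos, mul_one] at hle

/-- A nonvanishing holomorphic function on a disc has a holomorphic square root. -/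
theorem exists_holomorphic_sq_eq {g : ℂ → ℂ} {c : ℂ} {r : ℝ} (hr : 0 < r)
    (hg : DifferentiableOn ℂ g (ball c r)) (hg0 : ∀ ξ ∈ ball c r, g ξ ≠ 0) :
    ∃ s : ℂ → ℂ, DifferentiableOn ℂ s (ball c r) ∧ ∀ ξ ∈ ball c r, s ξ ^ 2 = g ξ := by
  have hc : c ∈ ball c r := mem_ball_self hr
  have hlog : DifferentiableOn ℂ (fun ξ => deriv g ξ / g ξ) (ball c r) :=
    (hg.deriv isOpen_ball).div hg hg0
  obtain ⟨L, hLc, hL⟩ := hlog.isExactOn_ball.with_val_at c (log (g c))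
  have hLd : DifferentiableOn ℂ L (ball c r) :=
    fun ξ hξ => (hL ξ hξ).differentiableAt.differentiableWithinAt
  have hconst : ∀ ξ ∈ ball c r, g ξ * exp (-L ξ) = 1 := by
    have hder : ∀ ξ ∈ ball c r, HasDerivAt (fun ξ => g ξ * exp (-L ξ)) 0 ξ := by
      intro ξ hξ
      refine ((hg.differentiableAt_ball hξ).hasDerivAt.mul (hL ξ hξ).neg.cexp).congr_deriv ?_
      have := hg0 ξ hξ
      field_simp
      ring
    intro ξ hξ
    have := isOpen_ball.is_const_of_deriv_eq_zero (convex_ball c r).isPreconnected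
      (fun ξ hξ => (hder ξ hξ).differentiableAt.differentiableWithinAt)
      (fun ξ hξ => (hder ξ hξ).deriv) hξ hc
    rw [this, hLc, exp_neg, exp_log (hg0 c hc), mul_inv_cancel₀ (hg0 c hc)]
  refine ⟨fun ξ => exp (L ξ / 2), (hLd.div_const 2).cexp, fun ξ hξ => ?_⟩
  rw [← exp_nat_mul]
  have h1 := hconst ξ hξ
  rw [exp_neg, mul_inv_eq_one₀ (exp_ne_zero _)] at h1
  rw [h1]
  congr 1
  push_cast
  ring

/-- A holomorphic function `F` on the unit disc with `F 0 = z₀` through which every holomorphic map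
from the unit disc to `Ω` lifts, with a prescribed lift of its value at `0`. -/
structure IsLiftingMap (Ω : Set ℂ) (z₀ : ℂ) (F : ℂ → ℂ) : Prop where
  differentiableOn : DifferentiableOn ℂ F (ball 0 1)
  map_zero : F 0 = z₀
  exists_lift : ∀ ζ ∈ ball (0 : ℂ) 1, ∀ f : ℂ → ℂ, DifferentiableOn ℂ f (ball 0 1) →
    MapsTo f (ball 0 1) Ω → f 0 = F ζ → ∃ φ : ℂ → ℂ, DifferentiableOn ℂ φ (ball 0 1) ∧
      MapsTo φ (ball 0 1) (ball 0 1) ∧ φ 0 = ζ ∧ EqOn (F ∘ φ) f (ball 0 1)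

/-- The degree two Blaschke product fixing `0` with critical value `b ^ 2`. -/
noncomputable def koebeMap (b ζ : ℂ) : ℂ := discInvolution (b ^ 2) (discInvolution b ζ ^ 2)

namespace koebeMap

variable {b : ℂ}

theorem norm_sq_lt_one {b : ℂ} (hb : ‖b‖ < 1) : ‖b ^ 2‖ < 1 := by
  rw [norm_pow]; nlinarith [norm_nonneg b]

theorem mapsTo_sq : MapsTo (fun w : ℂ => w ^ 2) (ball 0 1) (ball 0 1) := fun w hw => by
  simpa using norm_sq_lt_one (b := w) (by simpa using hw)

theorem mapsTo (hb : ‖b‖ < 1) : MapsTo (koebeMap b) (ball 0 1) (ball 0 1) :=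
  (discInvolution.mapsTo (norm_sq_lt_one hb)).comp (mapsTo_sq.comp (discInvolution.mapsTo hb))

@[simp] theorem apply_zero (b : ℂ) : koebeMap b 0 = 0 := by simp [koebeMap]

theorem differentiableOn (hb : ‖b‖ < 1) : DifferentiableOn ℂ (koebeMap b) (ball 0 1) :=
  (discInvolution.differentiableOn (norm_sq_lt_one hb)).comp
    ((discInvolution.differentiableOn hb).pow 2) (mapsTo_sq.comp (discInvolution.mapsTo hb))

theorem norm_deriv_zero (hb : ‖b‖ < 1) :
    ‖deriv (koebeMap b) 0‖ = 2 * ‖b‖ / (1 + ‖b‖ ^ 2) := by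
  have hb2 := norm_sq_lt_one hb
  have h0 : (0 : ℂ) ∈ ball (0 : ℂ) 1 := by simp
  have h1 : HasDerivAt (discInvolution b) (deriv (discInvolution b) 0) 0 :=
    ((discInvolution.differentiableOn hb).differentiableAt_ball h0).hasDerivAt
  have h2 : HasDerivAt (discInvolution (b ^ 2)) (deriv (discInvolution (b ^ 2)) (b ^ 2))
      (discInvolution b 0 ^ 2) := by
    rw [discInvolution.apply_zero]
    exact ((discInvolution.differentiableOn hb2).differentiableAt_ball
      (by simpa using hb2)).hasDerivAt
  have h3 : HasDerivAt (koebeMap b) _ 0 := h2.comp (0 : ℂ) (h1.pow 2)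
  rw [h3.deriv]
  simp only [discInvolution.apply_zero, norm_mul, discInvolution.norm_deriv_zero hb,
    discInvolution.norm_deriv_self hb2, norm_pow]
  have hp : 0 < 1 - ‖b‖ ^ 2 := by nlinarith [norm_nonneg b]
  have hq : 0 < 1 + ‖b‖ ^ 2 := by positivity
  have hr : 1 - (‖b‖ ^ 2) ^ 2 = (1 - ‖b‖ ^ 2) * (1 + ‖b‖ ^ 2) := by ring
  rw [hr]
  simp only [norm_natCast]
  field_simp
  norm_num [mul_comm]

/-- A holomorphic self-map of the disc omitting the critical value lifts through `koebeMap`. -/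
theorem exists_lift (hb : ‖b‖ < 1) {ζ : ℂ} (hζ : ζ ∈ ball (0 : ℂ) 1) {φ : ℂ → ℂ}
    (hd : DifferentiableOn ℂ φ (ball 0 1)) (hm : MapsTo φ (ball 0 1) (ball 0 1))
    (hne : ∀ ξ ∈ ball (0 : ℂ) 1, φ ξ ≠ b ^ 2) (h0 : φ 0 = koebeMap b ζ) :
    ∃ ψ : ℂ → ℂ, DifferentiableOn ℂ ψ (ball 0 1) ∧ MapsTo ψ (ball 0 1) (ball 0 1) ∧
      ψ 0 = ζ ∧ EqOn (koebeMap b ∘ ψ) φ (ball 0 1) := by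
  have hb2 := norm_sq_lt_one hb
  have hinv : ∀ ξ ∈ ball (0 : ℂ) 1, discInvolution (b ^ 2) (discInvolution (b ^ 2) (φ ξ)) = φ ξ :=
    fun ξ hξ => discInvolution.involutive hb2 (by simpa using hm hξ)
  obtain ⟨s, hsd, hs⟩ : ∃ s : ℂ → ℂ, DifferentiableOn ℂ s (ball 0 1) ∧
      ∀ ξ ∈ ball (0 : ℂ) 1, s ξ ^ 2 = discInvolution (b ^ 2) (φ ξ) := by
    refine exists_holomorphic_sq_eq (g := discInvolution (b ^ 2) ∘ φ) one_pos
      ((discInvolution.differentiableOn hb2).comp hd hm) fun ξ hξ h => hne ξ hξ ?_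
    rw [← hinv ξ hξ, show discInvolution (b ^ 2) (φ ξ) = 0 from h, discInvolution.apply_zero]
  have hζ1 : ‖ζ‖ < 1 := by simpa using hζ
  have h00 : (0 : ℂ) ∈ ball (0 : ℂ) 1 := by simp
  have hsgn : s 0 ^ 2 = discInvolution b ζ ^ 2 := by
    rw [hs 0 h00, h0, koebeMap, discInvolution.involutive hb2]
    exact norm_sq_lt_one (discInvolution.norm_lt_one hb hζ1)
  obtain ⟨t, htd, ht, ht0⟩ : ∃ t : ℂ → ℂ, DifferentiableOn ℂ t (ball 0 1) ∧
      (∀ ξ ∈ ball (0 : ℂ) 1, t ξ ^ 2 = discInvolution (b ^ 2) (φ ξ)) ∧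
      t 0 = discInvolution b ζ := by
    rcases sq_eq_sq_iff_eq_or_eq_neg.mp hsgn with h | h
    · exact ⟨s, hsd, hs, h⟩
    · exact ⟨fun ξ => -s ξ, hsd.neg, fun ξ hξ => by rw [neg_sq, hs ξ hξ], by simp [h]⟩
  have htm : MapsTo t (ball 0 1) (ball 0 1) := fun ξ hξ => by
    have h1 : ‖t ξ‖ ^ 2 < 1 := by
      rw [← norm_pow, ht ξ hξ]
      exact discInvolution.norm_lt_one hb2 (by simpa using hm hξ)
    have : ‖t ξ‖ < 1 := by nlinarith [norm_nonneg (t ξ)]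
    simpa using this
  refine ⟨discInvolution b ∘ t, (discInvolution.differentiableOn hb).comp htd htm,
    (discInvolution.mapsTo hb).comp htm, ?_, fun ξ hξ => ?_⟩
  · simp only [Function.comp, ht0, discInvolution.involutive hb hζ1]
  · simp only [Function.comp, koebeMap]
    rw [discInvolution.involutive hb (by simpa using htm hξ), ht ξ hξ, hinv ξ hξ]

end koebeMap

namespace IsLiftingMap

variable {Ω : Set ℂ} {z₀ : ℂ} {F : ℂ → ℂ}

theorem comp_koebeMap (hF : IsLiftingMap Ω z₀ F) {b : ℂ} (hb : ‖b‖ < 1) (hFb : F (b ^ 2) ∉ Ω) :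
    IsLiftingMap Ω z₀ (F ∘ koebeMap b) where
  differentiableOn := hF.differentiableOn.comp (koebeMap.differentiableOn hb) (koebeMap.mapsTo hb)
  map_zero := by simp [hF.map_zero]
  exists_lift := by
    intro ζ hζ f hfd hfm hf0
    obtain ⟨φ, hφd, hφm, hφ0, hφ⟩ := hF.exists_lift _ (koebeMap.mapsTo hb hζ) f hfd hfm hf0
    obtain ⟨ψ, hψd, hψm, hψ0, hψ⟩ := koebeMap.exists_lift hb hζ hφd hφm
      (fun ξ hξ h => hFb (by rw [← h, show F (φ ξ) = f ξ from hφ hξ]; exact hfm hξ)) hφ0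
    refine ⟨ψ, hψd, hψm, hψ0, fun ξ hξ => ?_⟩
    rw [← hφ hξ]
    exact congrArg F (hψ hξ)

theorem norm_deriv_comp_koebeMap (hF : IsLiftingMap Ω z₀ F) {b : ℂ} (hb : ‖b‖ < 1) :
    ‖deriv (F ∘ koebeMap b) 0‖ = ‖deriv F 0‖ * (2 * ‖b‖ / (1 + ‖b‖ ^ 2)) := by
  have h0 : (0 : ℂ) ∈ ball (0 : ℂ) 1 := by simp
  rw [deriv_comp _ (hF.differentiableOn.differentiableAt_ball (by simp))
    ((koebeMap.differentiableOn hb).differentiableAt_ball h0), norm_mul,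
    koebeMap.norm_deriv_zero hb, koebeMap.apply_zero]

/-- An affine parametrization of a disc containing `Ω` is a lifting map. -/
theorem affine {R : ℝ} (hR : 0 < R) (hΩ : Ω ⊆ ball z₀ R) :
    IsLiftingMap Ω z₀ (fun ζ => z₀ + R * ζ) where
  differentiableOn := by fun_prop
  map_zero := by simp
  exists_lift := by
    intro ζ hζ f hfd hfm hf0
    have hRc : (R : ℂ) ≠ 0 := by exact_mod_cast hR.ne'
    refine ⟨fun ξ => (f ξ - z₀) / R, (hfd.sub_const z₀).div_const _, fun ξ hξ => ?_, ?_,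
      fun ξ hξ => ?_⟩
    · have := hΩ (hfm hξ)
      rw [mem_ball, dist_eq] at this
      rw [mem_ball_zero_iff, norm_div, norm_real, Real.norm_of_nonneg hR.le, div_lt_one hR]
      exact this
    · simp only [hf0]; field_simp; ring
    · simp only [Function.comp]; field_simp; ring

/-- The local inverse branch of a lifting map on a disc around the base point. -/
theorem exists_lift_ball (hF : IsLiftingMap Ω z₀ F) {ρ : ℝ} (hρ : 0 < ρ) (hΩ : ball z₀ ρ ⊆ Ω) :
    ∃ φ : ℂ → ℂ, DifferentiableOn ℂ φ (ball 0 1) ∧ MapsTo φ (ball 0 1) (ball 0 1) ∧ φ 0 = 0 ∧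
      (∀ ξ ∈ ball (0 : ℂ) 1, F (φ ξ) = z₀ + ρ * ξ) ∧
      ∀ ξ ∈ ball (0 : ℂ) 1, deriv F (φ ξ) * deriv φ ξ = ρ := by
  have hmaps : MapsTo (fun ξ : ℂ => z₀ + ρ * ξ) (ball 0 1) Ω := fun ξ hξ => by
    apply hΩ
    rw [mem_ball, dist_eq, add_sub_cancel_left, norm_mul, norm_real, Real.norm_of_nonneg hρ.le]
    have : ‖ξ‖ < 1 := by simpa using hξ
    nlinarith
  obtain ⟨φ, hφd, hφm, hφ0, hφ⟩ := hF.exists_lift 0 (by simp) (fun ξ => z₀ + ρ * ξ) (by fun_prop)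
    hmaps (by simp [hF.map_zero])
  refine ⟨φ, hφd, hφm, hφ0, hφ, fun ξ hξ => ?_⟩
  rw [← deriv_comp _ (hF.differentiableOn.differentiableAt_ball (hφm hξ))
    (hφd.differentiableAt_ball hξ),
    (hφ.eventuallyEq_of_mem (isOpen_ball.mem_nhds hξ)).deriv_eq]
  simp

theorem le_norm_deriv_zero (hF : IsLiftingMap Ω z₀ F) {ρ : ℝ} (hρ : 0 < ρ)
    (hΩ : ball z₀ ρ ⊆ Ω) : ρ ≤ ‖deriv F 0‖ := by
  obtain ⟨φ, hφd, hφm, hφ0, -, hφ⟩ := hF.exists_lift_ball hρ hΩ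
  have h := congrArg norm (hφ 0 (by simp))
  rw [norm_mul, hφ0, norm_real, Real.norm_of_nonneg hρ.le] at h
  have h1 := norm_deriv_zero_le_one_sub_sq hφd hφm
  rw [hφ0] at h1
  have h2 : ‖deriv φ 0‖ ≤ 1 := by simpa using h1
  rw [← h]
  exact mul_le_of_le_one_right (norm_nonneg _) h2

end IsLiftingMap

/-- There are lifting maps sending arbitrarily large subdiscs of the unit disc into `Ω`. -/
theorem exists_isLiftingMap_mapsTo {Ω : Set ℂ} (hΩo : IsOpen Ω) (hΩb : Bornology.IsBounded Ω)
    {z₀ : ℂ} (hz₀ : z₀ ∈ Ω) {r : ℝ} (hr0 : 0 < r) (hr1 : r < 1) :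
    ∃ F, IsLiftingMap Ω z₀ F ∧ MapsTo F (ball 0 r) Ω := by
  obtain ⟨ρ, hρ, hρΩ⟩ := isOpen_iff.mp hΩo z₀ hz₀
  obtain ⟨R, hR, hRΩ⟩ := hΩb.subset_ball_lt 0 z₀
  let S : Set ℝ := {m | ∃ F, IsLiftingMap Ω z₀ F ∧ ‖deriv F 0‖ = m}
  have hSne : S.Nonempty := ⟨_, _, IsLiftingMap.affine hR hRΩ, rfl⟩
  have hSlb : ∀ m ∈ S, ρ ≤ m := by
    rintro _ ⟨F, hF, rfl⟩
    exact hF.le_norm_deriv_zero hρ hρΩ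
  have hSbdd : BddBelow S := ⟨ρ, hSlb⟩
  have hm : 0 < sInf S := hρ.trans_le (le_csInf hSne hSlb)
  have hc0 : 0 < √r := Real.sqrt_pos.mpr hr0
  have hc1 : √r < 1 := by simpa using Real.sqrt_lt_sqrt hr0.le hr1
  have hq1 : 2 * √r / (1 + √r ^ 2) < 1 := by
    rw [div_lt_one (by positivity)]
    nlinarith
  have hq0 : 0 < 2 * √r / (1 + √r ^ 2) := by positivity
  obtain ⟨_, ⟨F, hF, rfl⟩, hFlt⟩ := exists_lt_of_csInf_lt hSne
    ((lt_div_iff₀ hq0).mpr (mul_lt_of_lt_one_right hm hq1))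
  refine ⟨F, hF, fun a ha => ?_⟩
  by_contra hFa
  obtain ⟨b, rfl⟩ := IsAlgClosed.exists_pow_nat_eq a two_pos
  have hbr : ‖b‖ < √r := by
    apply Real.lt_sqrt_of_sq_lt
    simpa using ha
  have hb1 : ‖b‖ < 1 := hbr.trans hc1
  have hle := csInf_le hSbdd ⟨_, hF.comp_koebeMap hb1 hFa, rfl⟩
  rw [hF.norm_deriv_comp_koebeMap hb1] at hle
  have hmono : 2 * ‖b‖ / (1 + ‖b‖ ^ 2) ≤ 2 * √r / (1 + √r ^ 2) := by
    rw [div_le_div_iff₀ (by positivity) (by positivity)]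
    have h1 : 0 ≤ √r - ‖b‖ := by linarith
    have h2 : 0 ≤ 1 - √r * ‖b‖ := by nlinarith [norm_nonneg b]
    nlinarith [mul_nonneg h1 h2]
  rw [lt_div_iff₀ hq0] at hFlt
  exact absurd (hle.trans (mul_le_mul_of_nonneg_left hmono (norm_nonneg _))) (not_le.mpr hFlt)

/-- The values `‖f' 0‖` of holomorphic maps `f` from the unit disc to `Ω` with `f 0 = z`. -/
def discDerivs (Ω : Set ℂ) (z : ℂ) : Set ℝ :=
  {k | ∃ f : ℂ → ℂ, DifferentiableOn ℂ f (ball 0 1) ∧ MapsTo f (ball 0 1) Ω ∧ f 0 = z ∧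
    ‖deriv f 0‖ = k}

/-- The supremum of `‖f' 0‖` over holomorphic maps `f` from the unit disc to `Ω` with `f 0 = z`,
the reciprocal of the density of the Kobayashi metric. -/
noncomputable def kobayashiRadius (Ω : Set ℂ) (z : ℂ) : ℝ := sSup (discDerivs Ω z)

theorem discDerivs_bddAbove {Ω : Set ℂ} (hΩb : Bornology.IsBounded Ω) (z : ℂ) :
    BddAbove (discDerivs Ω z) := by
  obtain ⟨R, hR, hRΩ⟩ := hΩb.subset_ball_lt 0 z
  refine ⟨R / 1, ?_⟩
  rintro _ ⟨f, hfd, hfm, hf0, rfl⟩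
  refine norm_deriv_le_div_of_mapsTo_ball hfd ?_ one_pos
  rw [hf0]
  exact hfm.mono_right (hRΩ.trans ball_subset_closedBall)

theorem discDerivs_nonempty {Ω : Set ℂ} {z : ℂ} (hz : z ∈ Ω) : (discDerivs Ω z).Nonempty :=
  ⟨_, fun _ => z, by fun_prop, fun _ _ => hz, rfl, rfl⟩

namespace IsLiftingMap

variable {Ω : Set ℂ} {z₀ : ℂ} {F : ℂ → ℂ}

theorem kobayashiRadius_le (hF : IsLiftingMap Ω z₀ F) {ζ : ℂ} (hζ : ζ ∈ ball (0 : ℂ) 1)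
    (hFζ : F ζ ∈ Ω) : kobayashiRadius Ω (F ζ) ≤ ‖deriv F ζ‖ * (1 - ‖ζ‖ ^ 2) := by
  refine csSup_le (discDerivs_nonempty hFζ) ?_
  rintro _ ⟨f, hfd, hfm, hf0, rfl⟩
  obtain ⟨φ, hφd, hφm, hφ0, hφ⟩ := hF.exists_lift ζ hζ f hfd hfm hf0
  have h0 : (0 : ℂ) ∈ ball (0 : ℂ) 1 := by simp
  rw [← (hφ.eventuallyEq_of_mem (isOpen_ball.mem_nhds h0)).deriv_eq,
    deriv_comp _ (hF.differentiableOn.differentiableAt_ball (hφm h0))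
      (hφd.differentiableAt_ball h0), norm_mul, hφ0]
  have := norm_deriv_zero_le_one_sub_sq hφd hφm
  rw [hφ0] at this
  exact mul_le_mul_of_nonneg_left this (norm_nonneg _)

theorem le_kobayashiRadius (hF : IsLiftingMap Ω z₀ F) (hΩb : Bornology.IsBounded Ω) {r : ℝ}
    (hr0 : 0 < r) (hr1 : r < 1) (hFr : MapsTo F (ball 0 r) Ω) {ζ : ℂ}
    (hζ : ζ ∈ ball (0 : ℂ) r) :
    ‖deriv F ζ‖ * (r * (1 - ‖ζ / r‖ ^ 2)) ≤ kobayashiRadius Ω (F ζ) := by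
  have hrc : (r : ℂ) ≠ 0 := by exact_mod_cast hr0.ne'
  have h0 : (0 : ℂ) ∈ ball (0 : ℂ) 1 := by simp
  have hζr : ‖ζ / r‖ < 1 := by
    rw [norm_div, norm_real, Real.norm_of_nonneg hr0.le, div_lt_one hr0]
    simpa using hζ
  have hM : MapsTo (fun ξ => (r : ℂ) * discInvolution (ζ / r) ξ) (ball 0 1) (ball 0 r) := by
    intro ξ hξ
    have := discInvolution.norm_lt_one hζr (by simpa using hξ)
    rw [mem_ball_zero_iff, norm_mul, norm_real, Real.norm_of_nonneg hr0.le]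
    nlinarith
  have hMd : DifferentiableOn ℂ (fun ξ => (r : ℂ) * discInvolution (ζ / r) ξ) (ball 0 1) :=
    (discInvolution.differentiableOn hζr).const_mul _
  have hrζ : (r : ℂ) * (ζ / r) = ζ := by field_simp
  have hF1 := hF.differentiableOn.mono (ball_subset_ball hr1.le)
  refine le_csSup (discDerivs_bddAbove hΩb _)
    ⟨F ∘ (fun ξ => (r : ℂ) * discInvolution (ζ / r) ξ), hF1.comp hMd hM, hFr.comp hM, ?_, ?_⟩
  · simp [hrζ]
  · rw [deriv_comp (h := fun ξ => (r : ℂ) * discInvolution (ζ / r) ξ) _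
        (hF1.differentiableAt_ball (hM h0)) (hMd.differentiableAt_ball h0),
      deriv_const_mul _ ((discInvolution.differentiableOn hζr).differentiableAt_ball h0)]
    simp only [norm_mul, discInvolution.norm_deriv_zero hζr, norm_real,
      Real.norm_of_nonneg hr0.le, discInvolution.apply_zero, hrζ]

end IsLiftingMap

/-- A weak form of Montel's theorem: a sequence of holomorphic self-maps of the disc converges
locally uniformly along the hyperfilter. -/
theorem exists_tendstoLocallyUniformlyOn_hyperfilter (φ : ℕ → ℂ → ℂ)
    (hd : ∀ n, DifferentiableOn ℂ (φ n) (ball 0 1))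
    (hm : ∀ n, MapsTo (φ n) (ball 0 1) (ball 0 1)) :
    ∃ ψ, TendstoLocallyUniformlyOn φ ψ (hyperfilter ℕ) (ball (0 : ℂ) 1) := by
  have hlim : ∀ ξ : ℂ, ∃ w, ξ ∈ ball (0 : ℂ) 1 →
      Tendsto (fun n => φ n ξ) (hyperfilter ℕ) (𝓝 w) := by
    intro ξ
    by_cases hξ : ξ ∈ ball (0 : ℂ) 1
    · have hle : ((hyperfilter ℕ).map (fun n => φ n ξ) : Filter ℂ) ≤ 𝓟 (closedBall 0 1) := by
        rw [le_principal_iff]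
        exact Eventually.of_forall (f := ((hyperfilter ℕ : Ultrafilter ℕ) : Filter ℕ))
          fun n => ball_subset_closedBall (hm n hξ)
      obtain ⟨w, -, hw⟩ := (isCompact_closedBall (0 : ℂ) 1).ultrafilter_le_nhds _ hle
      exact ⟨w, fun _ => hw⟩
    · exact ⟨0, fun h => absurd h hξ⟩
  choose ψ hψ using hlim
  refine ⟨ψ, Metric.tendstoLocallyUniformlyOn_iff.mpr fun ε hε x hx => ?_⟩
  have hx1 : ‖x‖ < 1 := by simpa using hx
  set d : ℝ := 1 - ‖x‖ with hd_def
  have hd0 : 0 < d := by linarith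
  have hsub : ball x d ⊆ ball 0 1 := ball_subset_ball' (by simp [d])
  have hlip : ∀ n, ∀ y ∈ ball x d, dist (φ n y) (φ n x) ≤ 2 / d * dist y x := by
    intro n y hy
    refine dist_le_div_mul_dist_of_mapsTo_ball ((hd n).mono hsub) (fun w hw => ?_) hy
    have h1 : ‖φ n w‖ < 1 := by simpa using hm n (hsub hw)
    have h2 : ‖φ n x‖ < 1 := by simpa using hm n hx
    rw [mem_closedBall, dist_eq]
    linarith [norm_sub_le (φ n w) (φ n x)]
  have hlipψ : ∀ y ∈ ball x d, dist (ψ y) (ψ x) ≤ 2 / d * dist y x := fun y hy =>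
    le_of_tendsto ((hψ y (hsub hy)).dist (hψ x hx)) (Eventually.of_forall fun n => hlip n y hy)
  set δ : ℝ := min d (ε * d / 6) with hδ_def
  have hδ : 0 < δ := lt_min hd0 (by positivity)
  refine ⟨ball x δ, mem_nhdsWithin_of_mem_nhds (ball_mem_nhds x hδ), ?_⟩
  filter_upwards [(Metric.tendsto_nhds.mp (hψ x hx)) (ε / 3) (by positivity)] with n hn y hy
  have hyd : y ∈ ball x d := ball_subset_ball (min_le_left _ _) hy
  have hsmall : 2 / d * dist y x < ε / 3 := by
    have h1 : dist y x < ε * d / 6 := (mem_ball.mp hy).trans_le (min_le_right _ _)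
    calc 2 / d * dist y x < 2 / d * (ε * d / 6) := by gcongr
      _ = ε / 3 := by field_simp; norm_num
  have h1 := hlipψ y hyd
  have h2 := hlip n y hyd
  rw [dist_comm] at hn h2
  have := dist_triangle4 (ψ y) (ψ x) (φ n x) (φ n y)
  linarith

/-- Near each point, the Kobayashi radius is induced by a holomorphic map to the unit disc. -/
theorem exists_kobayashiRadius_mul_norm_deriv_eq {Ω : Set ℂ} (hΩo : IsOpen Ω)
    (hΩb : Bornology.IsBounded Ω) {z₀ : ℂ} {ρ : ℝ} (hρ : 0 < ρ) (hρΩ : ball z₀ ρ ⊆ Ω) :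
    ∃ ψ : ℂ → ℂ, DifferentiableOn ℂ ψ (ball 0 1) ∧ MapsTo ψ (ball 0 1) (ball 0 1) ∧
      ∀ ξ ∈ ball (0 : ℂ) 1,
        kobayashiRadius Ω (z₀ + ρ * ξ) * ‖deriv ψ ξ‖ = ρ * (1 - ‖ψ ξ‖ ^ 2) := by
  have hz₀ : z₀ ∈ Ω := hρΩ (mem_ball_self hρ)
  let r : ℕ → ℝ := fun n => 1 - 1 / ((n : ℝ) + 2)
  have hr0 : ∀ n, 0 < r n := fun n => by
    simp only [r, sub_pos]; rw [div_lt_one (by positivity)]; linarith [n.cast_nonneg (α := ℝ)]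
  have hr1 : ∀ n, r n < 1 := fun n => by simp only [r, sub_lt_self_iff]; positivity
  have hrlim : Tendsto r atTop (𝓝 1) := by
    have h1 : Tendsto (fun n : ℕ => 1 / ((n : ℝ) + 2)) atTop (𝓝 0) := by
      simp only [one_div]
      exact tendsto_inv_atTop_zero.comp
        (tendsto_atTop_add_const_right _ _ tendsto_natCast_atTop_atTop)
    have h2 := h1.const_sub 1
    rwa [sub_zero] at h2
  choose F hF hFr using fun n => exists_isLiftingMap_mapsTo hΩo hΩb hz₀ (hr0 n) (hr1 n)
  choose φ hφd hφm hφ0 hφ hφ' using fun n => (hF n).exists_lift_ball hρ hρΩ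
  obtain ⟨ψ, hψ⟩ := exists_tendstoLocallyUniformlyOn_hyperfilter φ hφd hφm
  have hrlim' : Tendsto r (hyperfilter ℕ) (𝓝 1) :=
    hrlim.mono_left (Nat.hyperfilter_le_atTop)
  have hψle : ∀ ξ ∈ ball (0 : ℂ) 1, ‖ψ ξ‖ ≤ ‖ξ‖ := fun ξ hξ =>
    le_of_tendsto (hψ.tendsto_at hξ).norm <| Eventually.of_forall fun n =>
      norm_le_norm_of_mapsTo_ball (hφd n) ((hφm n).mono_right ball_subset_closedBall) (hφ0 n)
        (by simpa using hξ)
  have hdlim := hψ.deriv (Eventually.of_forall hφd) isOpen_ball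
  refine ⟨ψ, hψ.differentiableOn (Eventually.of_forall hφd) isOpen_ball, fun ξ hξ => ?_,
    fun ξ hξ => ?_⟩
  · have : ‖ξ‖ < 1 := by simpa using hξ
    simpa using (hψle ξ hξ).trans_lt this
  have hξ1 : ‖ξ‖ < 1 := by simpa using hξ
  have hρξ : z₀ + ρ * ξ ∈ Ω := by
    apply hρΩ
    rw [mem_ball, dist_eq, add_sub_cancel_left, norm_mul, norm_real, Real.norm_of_nonneg hρ.le]
    nlinarith
  have hmul : ∀ n, ‖deriv (F n) (φ n ξ)‖ * ‖deriv (φ n) ξ‖ = ρ := fun n => by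
    rw [← norm_mul, hφ' n ξ hξ, norm_real, Real.norm_of_nonneg hρ.le]
  have hlimφ := (hψ.tendsto_at hξ)
  have hlimd : Tendsto (fun n => ‖deriv (φ n) ξ‖) (hyperfilter ℕ) (𝓝 ‖deriv ψ ξ‖) :=
    (hdlim.tendsto_at hξ).norm
  have hlimK := hlimd.const_mul (kobayashiRadius Ω (z₀ + ρ * ξ))
  apply le_antisymm
  · refine le_of_tendsto_of_tendsto hlimK (((hlimφ.norm.pow 2).const_sub 1).const_mul ρ)
      (Eventually.of_forall fun n => ?_)
    have h1 := (hF n).kobayashiRadius_le (hφm n hξ) (by rw [hφ n ξ hξ]; exact hρξ)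
    rw [hφ n ξ hξ] at h1
    have h2 := mul_le_mul_of_nonneg_right h1 (norm_nonneg (deriv (φ n) ξ))
    rwa [mul_right_comm, hmul] at h2
  · have hlimr : Tendsto (fun n => ρ * (r n * (1 - ‖φ n ξ / (r n : ℂ)‖ ^ 2))) (hyperfilter ℕ)
        (𝓝 (ρ * (1 * (1 - ‖ψ ξ / ((1 : ℝ) : ℂ)‖ ^ 2)))) := by
      refine (hrlim'.mul (Tendsto.const_sub 1 (Tendsto.pow (Tendsto.norm ?_) 2))).const_mul ρ
      exact hlimφ.div ((continuous_ofReal.tendsto 1).comp hrlim') (by simp)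
    have hlimr' : Tendsto (fun n => ρ * (r n * (1 - ‖φ n ξ / (r n : ℂ)‖ ^ 2))) (hyperfilter ℕ)
        (𝓝 (ρ * (1 - ‖ψ ξ‖ ^ 2))) := by simpa using hlimr
    refine le_of_tendsto_of_tendsto hlimr' hlimK ?_
    filter_upwards [hrlim'.eventually (lt_mem_nhds hξ1)] with n hn
    have hmem : φ n ξ ∈ ball (0 : ℂ) (r n) := by
      have := norm_le_norm_of_mapsTo_ball (hφd n) ((hφm n).mono_right ball_subset_closedBall)
        (hφ0 n) (by simpa using hξ)
      simpa using this.trans_lt hn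
    have h1 := (hF n).le_kobayashiRadius hΩb (hr0 n) (hr1 n) (hFr n) hmem
    rw [hφ n ξ hξ] at h1
    have h2 := mul_le_mul_of_nonneg_right h1 (norm_nonneg (deriv (φ n) ξ))
    rwa [mul_right_comm, hmul] at h2

/-- The logarithm of the pullback under `Ψ` of the hyperbolic density of the unit disc. -/
noncomputable def logPullbackDensity (Ψ : ℂ → ℂ) (z : ℂ) : ℝ :=
  Real.log 2 + Real.log (‖deriv Ψ z‖ ^ 2) / 2 - Real.log (1 - ‖Ψ z‖ ^ 2)

/-- The `z`-derivative of `2 * logPullbackDensity Ψ`. -/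
noncomputable def logPullbackDensityDeriv (Ψ : ℂ → ℂ) (z : ℂ) : ℂ :=
  deriv (deriv Ψ) z / deriv Ψ z + 2 * conj (Ψ z) * deriv Ψ z / (1 - Ψ z * conj (Ψ z))

section line

variable {g : ℂ → ℂ} {z : ℂ}

theorem DifferentiableAt.hasDerivAt_line (hg : DifferentiableAt ℂ g z) (d : ℂ) :
    HasDerivAt (fun t : ℝ => g (z + t * d)) (deriv g z * d) 0 := by
  have h1 : HasDerivAt (fun t : ℝ => z + (t : ℂ) * d) d 0 := by
    simpa using ((HasDerivAt.ofReal_comp (hasDerivAt_id (0 : ℝ))).mul_const d).const_add z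
  have h2 : HasDerivAt g (deriv g z) (z + ((0 : ℝ) : ℂ) * d) := by simpa using hg.hasDerivAt
  exact h2.comp (0 : ℝ) h1

theorem DifferentiableAt.fderiv_eq_of_line {E : Type*} [NormedAddCommGroup E] [NormedSpace ℝ E]
    {v : ℂ → E} {v' : E} {d : ℂ} (hv : DifferentiableAt ℝ v z)
    (h : HasDerivAt (fun t : ℝ => v (z + t * d)) v' 0) : fderiv ℝ v z d = v' := by
  have h1 : HasDerivAt (fun t : ℝ => z + (t : ℂ) * d) d 0 := by
    simpa using ((HasDerivAt.ofReal_comp (hasDerivAt_id (0 : ℝ))).mul_const d).const_add z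
  have h2 : HasFDerivAt v (fderiv ℝ v z) (z + ((0 : ℝ) : ℂ) * d) := by simpa using hv.hasFDerivAt
  exact (h2.comp_hasDerivAt (0 : ℝ) h1).unique h

end line

section

variable {Ψ : ℂ → ℂ} {z : ℂ}

theorem one_sub_mul_conj_ne_zero (h1 : ‖Ψ z‖ < 1) : 1 - Ψ z * conj (Ψ z) ≠ 0 := by
  rw [mul_conj, normSq_eq_norm_sq]
  have : 1 - ‖Ψ z‖ ^ 2 ≠ 0 := by nlinarith [norm_nonneg (Ψ z)]
  exact_mod_cast this

theorem AnalyticAt.contDiffAt_logPullbackDensity (hΨ : AnalyticAt ℂ Ψ z) (h0 : deriv Ψ z ≠ 0)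
    (h1 : ‖Ψ z‖ < 1) {n : ℕ∞} : ContDiffAt ℝ n (logPullbackDensity Ψ) z := by
  have hP : ContDiffAt ℝ n Ψ z := hΨ.contDiffAt.restrict_scalars ℝ
  have hQ : ContDiffAt ℝ n (deriv Ψ) z := hΨ.deriv.contDiffAt.restrict_scalars ℝ
  have h2 : ‖deriv Ψ z‖ ^ 2 ≠ 0 := by simpa using h0
  have h3 : 1 - ‖Ψ z‖ ^ 2 ≠ 0 := by nlinarith [norm_nonneg (Ψ z)]
  exact (contDiffAt_const.add (((hQ.norm_sq ℝ).log h2).div_const 2)).sub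
    ((contDiffAt_const.sub (hP.norm_sq ℝ)).log h3)

theorem AnalyticAt.fderiv_logPullbackDensity (hΨ : AnalyticAt ℂ Ψ z) (h0 : deriv Ψ z ≠ 0)
    (h1 : ‖Ψ z‖ < 1) (d : ℂ) :
    fderiv ℝ (logPullbackDensity Ψ) z d = (logPullbackDensityDeriv Ψ z * d).re := by
  have h2 : ‖deriv Ψ z‖ ^ 2 ≠ 0 := by simpa using h0
  have h3 : 1 - ‖Ψ z‖ ^ 2 ≠ 0 := by nlinarith [norm_nonneg (Ψ z)]
  refine ((hΨ.contDiffAt_logPullbackDensity h0 h1 (n := 1)).differentiableAt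
    (by simp)).fderiv_eq_of_line ?_
  have hP := (hΨ.differentiableAt.hasDerivAt_line d).norm_sq
  have hQ := (hΨ.deriv.differentiableAt.hasDerivAt_line d).norm_sq
  refine (((hQ.log (by simpa using h0)).div_const 2).const_add (Real.log 2)).sub
    ((hP.const_sub 1).log (by simpa using h3)) |>.congr_deriv ?_
  simp only [ofReal_zero, zero_mul, add_zero, Complex.inner]
  have e1 : deriv (deriv Ψ) z / deriv Ψ z =
      deriv (deriv Ψ) z * conj (deriv Ψ z) * ((‖deriv Ψ z‖ ^ 2 : ℝ)⁻¹ : ℝ) := by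
    rw [mul_assoc, ← normSq_eq_norm_sq, div_eq_mul_inv, inv_def]
  have e2 : 2 * conj (Ψ z) * deriv Ψ z / (1 - Ψ z * conj (Ψ z)) =
      2 * conj (Ψ z) * deriv Ψ z * ((1 - ‖Ψ z‖ ^ 2 : ℝ)⁻¹ : ℝ) := by
    rw [mul_conj, normSq_eq_norm_sq, div_eq_mul_inv]; push_cast; rfl
  rw [logPullbackDensityDeriv, e1, e2]
  simp only [add_mul, mul_re, mul_im, add_re, conj_re, conj_im, ofReal_re, ofReal_im, re_ofNat,
    im_ofNat]
  field_simp
  ring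

theorem AnalyticAt.lap_logPullbackDensity (hΨ : AnalyticAt ℂ Ψ z) (h0 : deriv Ψ z ≠ 0)
    (h1 : ‖Ψ z‖ < 1) :
    lap (logPullbackDensity Ψ) z = Real.exp (2 * logPullbackDensity Ψ z) := by
  have hev : ∀ d : ℂ, (fun w => fderiv ℝ (logPullbackDensity Ψ) w d) =ᶠ[𝓝 z]
      fun w => (logPullbackDensityDeriv Ψ w * d).re := fun d => by
    filter_upwards [hΨ.eventually_analyticAt, hΨ.deriv.continuousAt.eventually_ne h0,
      hΨ.continuousAt.norm.eventually_lt_const h1] with w hw hw0 hw1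
    exact hw.fderiv_logPullbackDensity hw0 hw1 d
  set P := Ψ z with hPdef
  set Q := deriv Ψ z with hQdef
  set S := deriv (deriv Ψ) z with hSdef
  set B := deriv (fun w => deriv (deriv Ψ) w / deriv Ψ w) z with hBdef
  have hN : 1 - P * conj P ≠ 0 := one_sub_mul_conj_ne_zero h1
  have hBan : AnalyticAt ℂ (fun w => deriv (deriv Ψ) w / deriv Ψ w) z :=
    hΨ.deriv.deriv.div hΨ.deriv h0
  have hdiff : DifferentiableAt ℝ (logPullbackDensityDeriv Ψ) z := by
    have hB : DifferentiableAt ℝ (fun w => deriv (deriv Ψ) w / deriv Ψ w) z :=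
      hBan.differentiableAt.restrictScalars ℝ
    have hP : DifferentiableAt ℝ Ψ z := hΨ.differentiableAt.restrictScalars ℝ
    have hQ : DifferentiableAt ℝ (deriv Ψ) z := hΨ.deriv.differentiableAt.restrictScalars ℝ
    have hP' : DifferentiableAt ℝ (fun w => conj (Ψ w)) z := hP.star
    have hsum := hB.add (((hP'.const_mul 2).mul hQ).mul (((hP.mul hP').const_sub 1).inv hN))
    simp only [← div_eq_mul_inv] at hsum
    exact hsum
  have hder : ∀ d : ℂ, fderiv ℝ (fun w => (logPullbackDensityDeriv Ψ w * d).re) z d =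
      ((B * d + (2 * (conj (Q * d) * Q + conj P * (S * d)) * (1 - P * conj P) +
        2 * conj P * Q * (Q * d * conj P + P * conj (Q * d))) / (1 - P * conj P) ^ 2) * d).re := by
    intro d
    refine DifferentiableAt.fderiv_eq_of_line
      (reCLM.differentiableAt.comp z (hdiff.mul_const d)) ?_
    have hBl := hBan.differentiableAt.hasDerivAt_line d
    have hPl := hΨ.differentiableAt.hasDerivAt_line d
    have hQl := hΨ.deriv.differentiableAt.hasDerivAt_line d
    have hPc : HasDerivAt (fun t : ℝ => conj (Ψ (z + t * d))) (conj (Q * d)) 0 := hPl.star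
    have h := (hBl.add (((hPc.const_mul 2).mul hQl).div ((hPl.mul hPc).const_sub 1)
      (by simpa using hN))).mul_const d
    refine (reCLM.hasFDerivAt.comp_hasDerivAt (0 : ℝ) h).congr_deriv ?_
    simp only [Pi.mul_apply, ofReal_zero, zero_mul, add_zero, reCLM_apply, ← hPdef, ← hQdef,
      ← hSdef, ← hBdef]
    congr 4
    ring
  rw [lap, (hev 1).fderiv_eq, (hev I).fderiv_eq, hder, hder]
  have hQpos : 0 < ‖Q‖ ^ 2 := by have := norm_pos_iff.mpr h0; positivity
  have hNpos : 0 < 1 - ‖P‖ ^ 2 := by nlinarith [norm_nonneg P]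
  have hexp : Real.exp (2 * logPullbackDensity Ψ z) = 4 * ‖Q‖ ^ 2 / (1 - ‖P‖ ^ 2) ^ 2 := by
    rw [logPullbackDensity, show ∀ a b c : ℝ, 2 * (a + b / 2 - c) = 2 * a + b - 2 * c by
      intros; ring, Real.exp_sub, Real.exp_add, Real.exp_log hQpos, two_mul, two_mul,
      Real.exp_add, Real.exp_add, Real.exp_log two_pos, Real.exp_log hNpos]
    ring
  rw [hexp, ← ofReal_re (4 * ‖Q‖ ^ 2 / (1 - ‖P‖ ^ 2) ^ 2), ← add_re]
  congr 1
  have hPn : ((‖P‖ ^ 2 : ℝ) : ℂ) = P * conj P := by rw [mul_conj, normSq_eq_norm_sq]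
  have hQn : ((‖Q‖ ^ 2 : ℝ) : ℂ) = Q * conj Q := by rw [mul_conj, normSq_eq_norm_sq]
  rw [ofReal_div, ofReal_mul, ofReal_pow (1 - _), ofReal_sub, hPn, hQn]
  simp only [map_mul, conj_I, mul_one, ofReal_one, ofReal_ofNat]
  field_simp
  ring_nf
  simp only [I_sq]
  ring

end

theorem Filter.EventuallyEq.lap_eq {u v : ℂ → ℝ} {z : ℂ} (h : u =ᶠ[𝓝 z] v) :
    lap u z = lap v z := by
  have hd : ∀ d : ℂ, (fun w => fderiv ℝ u w d) =ᶠ[𝓝 z] fun w => fderiv ℝ v w d := fun d =>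
    (h.fderiv (𝕜 := ℝ)).mono fun w hw => congrArg (· d) hw
  rw [lap, lap, (hd 1).fderiv_eq, (hd I).fderiv_eq]

/-- The Schwarz–Pick inequality for maps from the disc to the right half-plane. -/
theorem norm_deriv_zero_le_of_re_pos {H : ℂ → ℂ} (hd : DifferentiableOn ℂ H (ball 0 1))
    (hH : ∀ ξ ∈ ball (0 : ℂ) 1, 0 < (H ξ).re) : ‖deriv H 0‖ ≤ 2 * (H 0).re := by
  have h0 : (0 : ℂ) ∈ ball (0 : ℂ) 1 := by simp
  have hne : ∀ ξ ∈ ball (0 : ℂ) 1, H ξ + conj (H 0) ≠ 0 := fun ξ hξ h => by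
    have h1 := congrArg re h
    simp only [add_re, conj_re, zero_re] at h1
    linarith [hH ξ hξ, hH 0 h0]
  let T : ℂ → ℂ := fun ξ => (H ξ - H 0) / (H ξ + conj (H 0))
  have hTd : DifferentiableOn ℂ T (ball 0 1) := (hd.sub_const _).div (hd.add_const _) hne
  have hTm : MapsTo T (ball 0 1) (closedBall (T 0) 1) := fun ξ hξ => by
    have hT0 : T 0 = 0 := by simp [T]
    rw [hT0, mem_closedBall_zero_iff, norm_div, div_le_one (norm_pos_iff.mpr (hne ξ hξ))]
    refine le_of_sq_le_sq ?_ (norm_nonneg _)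
    simp only [← normSq_eq_norm_sq, normSq_apply, sub_re, sub_im, add_re, add_im, conj_re, conj_im]
    nlinarith [mul_pos (hH ξ hξ) (hH 0 h0)]
  have hT := norm_deriv_le_one_of_mapsTo_ball hTd hTm one_pos
  have hH' := (hd.differentiableAt_ball h0).hasDerivAt
  have hT' : HasDerivAt T (deriv H 0 / ((2 * (H 0).re : ℝ) : ℂ)) 0 := by
    refine ((hH'.sub_const (H 0)).div (hH'.add_const (conj (H 0))) (hne 0 h0)).congr_deriv ?_
    have hne0 := hne 0 h0
    rw [add_conj] at hne0 ⊢
    rw [sub_self, zero_mul, sub_zero]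
    push_cast at hne0 ⊢
    field_simp
  have hpos : 0 < 2 * (H 0).re := by linarith [hH 0 h0]
  rwa [hT'.deriv, norm_div, norm_real, Real.norm_of_nonneg hpos.le, div_le_one hpos] at hT

/-- The Schwarz–Pick inequality for maps from the disc to the slit plane. -/
theorem norm_deriv_zero_le_of_mapsTo_slitPlane {G : ℂ → ℂ}
    (hd : DifferentiableOn ℂ G (ball 0 1)) (hG : MapsTo G (ball 0 1) slitPlane) :
    ‖deriv G 0‖ ≤ 4 * ‖G 0‖ := by
  have h0 : (0 : ℂ) ∈ ball (0 : ℂ) 1 := by simp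
  let H : ℂ → ℂ := fun ξ => exp (log (G ξ) / 2)
  have hHd : DifferentiableOn ℂ H (ball 0 1) := ((hd.clog hG).div_const 2).cexp
  have hHsq : ∀ ξ ∈ ball (0 : ℂ) 1, H ξ ^ 2 = G ξ := fun ξ hξ => by
    rw [← exp_nat_mul, Nat.cast_ofNat, mul_div_cancel₀ _ two_ne_zero,
      exp_log (slitPlane_ne_zero (hG hξ))]
  have hHre : ∀ ξ ∈ ball (0 : ℂ) 1, 0 < (H ξ).re := fun ξ hξ => by
    rw [exp_re]
    refine mul_pos (Real.exp_pos _) (Real.cos_pos_of_mem_Ioo ?_)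
    have him : (log (G ξ) / 2).im = arg (G ξ) / 2 := by
      rw [← log_im]; exact div_ofNat_im _ _
    have h1 := neg_pi_lt_arg (G ξ)
    have h2 := (arg_le_pi (G ξ)).lt_of_ne (mem_slitPlane_iff_arg.mp (hG hξ)).1
    rw [him]
    constructor <;> linarith
  have hH' := (hHd.differentiableAt_ball h0).hasDerivAt
  have hG' : deriv G 0 = 2 * H 0 * deriv H 0 := by
    have hEq : EqOn (fun ξ => H ξ ^ 2) G (ball 0 1) := hHsq
    rw [← (hEq.eventuallyEq_of_mem (isOpen_ball.mem_nhds h0)).deriv_eq]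
    simpa using (hH'.fun_pow 2).deriv
  have hre := re_le_norm (H 0)
  have hle := norm_deriv_zero_le_of_re_pos hHd hHre
  rw [hG', ← hHsq 0 h0, norm_mul, norm_mul, norm_pow]
  simp only [RCLike.norm_ofNat]
  nlinarith [norm_nonneg (H 0), norm_nonneg (deriv H 0)]

theorem div_sub_mem_slitPlane {p q z : ℂ} (hz : z ∉ segment ℝ p q) :
    (z - p) / (z - q) ∈ slitPlane := by
  by_contra hw
  have hzq : z - q ≠ 0 := fun h => hz (by rw [sub_eq_zero.mp h]; exact right_mem_segment ℝ p q)
  set w := (z - p) / (z - q) with hwdef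
  rw [mem_slitPlane_iff, not_or, not_lt, not_not] at hw
  obtain ⟨hre, him⟩ := hw
  obtain ⟨s, hs, hws⟩ : ∃ s : ℝ, 0 ≤ s ∧ w = -(s : ℂ) :=
    ⟨-w.re, by linarith, by apply Complex.ext <;> simp [him]⟩
  have hs1 : (0 : ℝ) < 1 + s := by linarith
  have heq : (1 + s : ℂ) * z = p + s * q := by
    have : z - p = -(s : ℂ) * (z - q) := by rw [← hws, hwdef, div_mul_cancel₀ _ hzq]
    linear_combination this
  have hs1c : (1 + s : ℂ) ≠ 0 := by exact_mod_cast hs1.ne'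
  refine hz ⟨1 / (1 + s), s / (1 + s), by positivity, by positivity, by field_simp, ?_⟩
  simp only [real_smul]
  push_cast
  field_simp
  rw [← heq]

theorem kobayashiRadius_le_of_disjoint_segment {Ω : Set ℂ} {p q z : ℂ} (hpq : p ≠ q)
    (hΩ : Disjoint (segment ℝ p q) Ω) (hz : z ∈ Ω) :
    kobayashiRadius Ω z ≤ 4 * ‖z - p‖ * ‖z - q‖ / ‖p - q‖ := by
  have hnot : ∀ w ∈ Ω, w ∉ segment ℝ p q := fun w hw h => disjoint_left.mp hΩ h hw
  refine csSup_le (discDerivs_nonempty hz) ?_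
  rintro _ ⟨f, hfd, hfm, hf0, rfl⟩
  have h0 : (0 : ℂ) ∈ ball (0 : ℂ) 1 := by simp
  have hne : ∀ ξ ∈ ball (0 : ℂ) 1, f ξ - q ≠ 0 := fun ξ hξ h =>
    hnot _ (hfm hξ) (by rw [sub_eq_zero.mp h]; exact right_mem_segment ℝ p q)
  have hG := norm_deriv_zero_le_of_mapsTo_slitPlane
    (((hfd.sub_const p).div (hfd.sub_const q) hne))
    (fun ξ hξ => div_sub_mem_slitPlane (hnot _ (hfm hξ)))
  have hf' := (hfd.differentiableAt_ball h0).hasDerivAt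
  have hG' := ((hf'.sub_const p).div (hf'.sub_const q) (hne 0 h0)).deriv
  rw [hG'] at hG
  have hzq : 0 < ‖z - q‖ := by have := norm_pos_iff.mpr (hne 0 h0); rwa [hf0] at this
  have hpq' : 0 < ‖p - q‖ := norm_pos_iff.mpr (sub_ne_zero.mpr hpq)
  rw [show deriv f 0 * (f 0 - q) - (f 0 - p) * deriv f 0 = deriv f 0 * (p - q) by ring] at hG
  simp only [Pi.div_apply, hf0, norm_div, norm_mul, norm_pow] at hG
  rw [le_div_iff₀ hpq']
  rw [div_le_iff₀ (by positivity)] at hG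
  refine hG.trans (le_of_eq ?_)
  field_simp

/-- The logarithm of the density of the Kobayashi metric of curvature `-1`. -/
noncomputable def logKobayashiDensity (Ω : Set ℂ) (z : ℂ) : ℝ :=
  Real.log (2 / kobayashiRadius Ω z)

theorem exists_logKobayashiDensity_eventuallyEq {Ω : Set ℂ} (hΩo : IsOpen Ω)
    (hΩb : Bornology.IsBounded Ω) {z : ℂ} (hz : z ∈ Ω) :
    0 < kobayashiRadius Ω z ∧ ∃ Ψ : ℂ → ℂ, AnalyticAt ℂ Ψ z ∧ deriv Ψ z ≠ 0 ∧ ‖Ψ z‖ < 1 ∧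
      logKobayashiDensity Ω =ᶠ[𝓝 z] logPullbackDensity Ψ := by
  obtain ⟨ρ, hρ, hρΩ⟩ := isOpen_iff.mp hΩo z hz
  obtain ⟨ψ, hψd, hψm, hψ⟩ := exists_kobayashiRadius_mul_norm_deriv_eq hΩo hΩb hρ hρΩ
  have hρc : (ρ : ℂ) ≠ 0 := by exact_mod_cast hρ.ne'
  let A : ℂ → ℂ := fun w => (w - z) / ρ
  have hA : MapsTo A (ball z ρ) (ball 0 1) := fun w hw => by
    rw [mem_ball_zero_iff, norm_div, norm_real, Real.norm_of_nonneg hρ.le, div_lt_one hρ,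
      ← dist_eq]
    exact hw
  have hAd : ∀ w, HasDerivAt A (1 / ρ) w := fun w =>
    ((hasDerivAt_id w).sub_const z).div_const (ρ : ℂ)
  have hΨd : DifferentiableOn ℂ (ψ ∘ A) (ball z ρ) :=
    hψd.comp (fun w _ => (hAd w).differentiableAt.differentiableWithinAt) hA
  have hlt : ∀ w ∈ ball z ρ, ‖(ψ ∘ A) w‖ < 1 := fun w hw => by simpa using hψm (hA hw)
  have hK : ∀ w ∈ ball z ρ,
      kobayashiRadius Ω w * ‖deriv (ψ ∘ A) w‖ = 1 - ‖(ψ ∘ A) w‖ ^ 2 := fun w hw => by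
    have h1 := hψ (A w) (hA hw)
    rw [show z + ρ * A w = w by simp only [A]; field_simp; ring] at h1
    rw [((hψd.differentiableAt_ball (hA hw)).hasDerivAt.comp w (hAd w)).deriv, norm_mul, norm_div,
      norm_real, Real.norm_of_nonneg hρ.le, norm_one, ← mul_assoc, h1]
    field_simp
    rfl
  have hpos : ∀ w ∈ ball z ρ, 0 < 1 - ‖(ψ ∘ A) w‖ ^ 2 := fun w hw => by
    nlinarith [norm_nonneg ((ψ ∘ A) w), hlt w hw]
  have hQ : ∀ w ∈ ball z ρ, 0 < ‖deriv (ψ ∘ A) w‖ := fun w hw =>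
    (norm_nonneg _).lt_of_ne fun h => (hpos w hw).ne (by rw [← hK w hw, ← h, mul_zero])
  have hzmem := mem_ball_self (x := z) hρ
  refine ⟨?_, ψ ∘ A, hΨd.analyticAt (isOpen_ball.mem_nhds hzmem), norm_pos_iff.mp (hQ z hzmem),
    hlt z hzmem, ?_⟩
  · have h1 := hpos z hzmem
    rw [← hK z hzmem] at h1
    exact pos_of_mul_pos_left h1 (norm_nonneg _)
  · filter_upwards [isOpen_ball.mem_nhds hzmem] with w hw
    have h1 := hpos w hw
    have h2 := hQ w hw
    rw [logKobayashiDensity, logPullbackDensity, eq_div_of_mul_eq h2.ne' (hK w hw),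
      div_div_eq_mul_div,
      Real.log_div (mul_pos two_pos h2).ne' h1.ne', Real.log_mul two_ne_zero h2.ne', Real.log_pow]
    push_cast
    ring

theorem tendsto_logKobayashiDensity {Ω : Set ℂ} (hΩo : IsOpen Ω) (hΩb : Bornology.IsBounded Ω)
    {p q : ℂ} (hpq : p ≠ q) (hΩ : Disjoint (segment ℝ p q) Ω) :
    Tendsto (logKobayashiDensity Ω) (𝓝[Ω] p) atTop := by
  have hlim : Tendsto (fun z => 4 * ‖z - p‖ * ‖z - q‖ / ‖p - q‖) (𝓝[Ω] p) (𝓝 0) := by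
    have hc : Continuous fun z => 4 * ‖z - p‖ * ‖z - q‖ / ‖p - q‖ := by fun_prop
    simpa using (hc.tendsto p).mono_left nhdsWithin_le_nhds
  have hpos : ∀ᶠ z in 𝓝[Ω] p, 0 < kobayashiRadius Ω z :=
    eventually_mem_nhdsWithin.mono fun z hz =>
      (exists_logKobayashiDensity_eventuallyEq hΩo hΩb hz).1
  have hK : Tendsto (kobayashiRadius Ω) (𝓝[Ω] p) (𝓝[>] 0) := by
    refine tendsto_nhdsWithin_iff.mpr ⟨squeeze_zero' (hpos.mono fun _ h => h.le) ?_ hlim, hpos⟩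
    exact eventually_mem_nhdsWithin.mono fun z hz =>
      kobayashiRadius_le_of_disjoint_segment hpq hΩ hz
  refine Real.tendsto_log_atTop.comp ?_
  simp only [div_eq_mul_inv]
  exact (tendsto_inv_nhdsGT_zero.comp hK).const_mul_atTop two_pos

theorem segment_subset_finiteCone {p e : ℂ} {h : ℝ} (θ₀ : ℝ) (hh : 0 ≤ h) (he : ‖e‖ = 1) :
    segment ℝ p (p + h • e) ⊆ finiteCone p e h θ₀ := by
  rintro _ ⟨a, b, ha, hb, hab, rfl⟩
  refine ⟨b * h, e, by positivity, mul_le_of_le_one_left hh (by linarith), he, ?_, ?_⟩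
  · have : realInner e e = 1 := by
      rw [realInner, ← normSq_apply, normSq_eq_norm_sq, he, one_pow]
    rw [this]
    exact Real.cos_le_one θ₀
  · rw [smul_add, ← add_assoc, ← add_smul, hab, one_smul, mul_smul]

end

/-- Theorem 2.2, existence: a bounded domain satisfying a uniform
exterior cone condition admits a smooth solution of Liouville's equation blowing
up at the boundary. -/
theorem liouville_existence (Ω : Set ℂ) (hΩopen : IsOpen Ω) (hΩconn : IsConnected Ω)
    (hΩbdd : Bornology.IsBounded Ω)
    (h θ₀ : ℝ) (hh : 0 < h) (hθ₀ : 0 < θ₀) (hθ₀' : θ₀ < Real.pi / 2)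
    (hcone : UnifExtCone Ω h θ₀) :
    ∃ u : ℂ → ℝ, ContDiffOn ℝ (⊤ : ℕ∞) u Ω ∧
      (∀ z ∈ Ω, lap u z = Real.exp (2 * u z)) ∧
      (∀ p ∈ frontier Ω, Filter.Tendsto u (nhdsWithin p Ω) Filter.atTop) := by
  refine ⟨logKobayashiDensity Ω, fun z hz => ?_, fun z hz => ?_, fun p hp => ?_⟩
  · obtain ⟨-, Ψ, hΨ, h0, h1, heq⟩ := exists_logKobayashiDensity_eventuallyEq hΩopen hΩbdd hz
    exact ((hΨ.contDiffAt_logPullbackDensity h0 h1).congr_of_eventuallyEq heq).contDiffWithinAt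
  · obtain ⟨-, Ψ, hΨ, h0, h1, heq⟩ := exists_logKobayashiDensity_eventuallyEq hΩopen hΩbdd hz
    rw [heq.lap_eq, heq.eq_of_nhds]
    exact hΨ.lap_logPullbackDensity h0 h1
  · obtain ⟨e, he, hdisj⟩ := hcone p hp
    refine tendsto_logKobayashiDensity hΩopen hΩbdd (q := p + h • e) ?_
      ((Set.disjoint_iff_inter_eq_empty.mpr hdisj).mono_left
        (segment_subset_finiteCone θ₀ hh.le he))
    have he0 : e ≠ 0 := norm_pos_iff.mp (he ▸ one_pos)
    simpa using ⟨hh.ne', he0⟩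
end

section
/- (Theorem 2.2, uniqueness) Let Ω ⊂ ℝ² be a bounded domain satisfying a uniform exterior cone condition. If u, v ∈ C^∞(Ω) both satisfy Δu = e^{2u}, Δv = e^{2v} in Ω and u(z) → +∞, v(z) → +∞ as z → ∂Ω, then u = v on Ω. -/
open Filter Topology Set

/-- A set on which a function stays at least `δ` is compact if the function drops below `δ` near
the boundary of the bounded open domain. -/
theorem isCompact_superlevel {D : Set ℂ} (hD : IsOpen D) (hb : Bornology.IsBounded D)
    {f : ℂ → ℝ} (hf : ContinuousOn f D) {δ : ℝ}
    (hfr : ∀ p ∈ frontier D, ∀ᶠ z in 𝓝[D] p, f z < δ) : IsCompact {z ∈ D | δ ≤ f z} := by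
  refine Metric.isCompact_of_isClosed_isBounded ?_ (hb.subset (sep_subset _ _))
  refine isClosed_of_closure_subset fun p hp => ?_
  have hfreq : ∃ᶠ z in 𝓝[D] p, δ ≤ f z := by
    rw [mem_closure_iff_frequently] at hp
    rw [frequently_nhdsWithin_iff]
    exact hp.mono fun z hz => ⟨hz.2, hz.1⟩
  have hpD : p ∈ D := by
    by_contra hpD
    have hpf : p ∈ frontier D := by
      rw [hD.frontier_eq]
      exact ⟨closure_mono (sep_subset _ _) hp, hpD⟩
    obtain ⟨z, h1, h2⟩ := (hfreq.and_eventually (hfr p hpf)).exists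
    linarith
  refine ⟨hpD, ?_⟩
  by_contra! hlt
  obtain ⟨z, h1, h2⟩ := (hfreq.and_eventually ((hf p hpD).eventually_lt_const hlt)).exists
  linarith

theorem differentiableAt_fderiv_apply {u : ℂ → ℝ} {z : ℂ} (hu : ContDiffAt ℝ 2 u z) (d : ℂ) :
    DifferentiableAt ℝ (fun w => fderiv ℝ u w d) z := by
  have h : ContDiffAt ℝ 1 (fderiv ℝ u) z := hu.fderiv_right (by norm_num)
  exact (h.differentiableAt (by norm_num)).clm_apply (differentiableAt_const d)

theorem eventually_differentiableAt {u : ℂ → ℝ} {z : ℂ} (hu : ContDiffAt ℝ 2 u z) :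
    ∀ᶠ w in 𝓝 z, DifferentiableAt ℝ u w :=
  (hu.eventually (by simp)).mono fun _ hw => hw.differentiableAt (by norm_num)

theorem fderiv_fderiv_sub {u v : ℂ → ℝ} {z : ℂ} (hu : ContDiffAt ℝ 2 u z)
    (hv : ContDiffAt ℝ 2 v z) (d : ℂ) :
    fderiv ℝ (fun w => fderiv ℝ (fun y => u y - v y) w d) z d =
      fderiv ℝ (fun w => fderiv ℝ u w d) z d - fderiv ℝ (fun w => fderiv ℝ v w d) z d := by
  have h : (fun w => fderiv ℝ (fun y => u y - v y) w d) =ᶠ[𝓝 z]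
      fun w => fderiv ℝ u w d - fderiv ℝ v w d := by
    filter_upwards [eventually_differentiableAt hu, eventually_differentiableAt hv] with w h1 h2
    rw [fderiv_fun_sub h1 h2]
    rfl
  rw [h.fderiv_eq, fderiv_fun_sub (differentiableAt_fderiv_apply hu d)
    (differentiableAt_fderiv_apply hv d)]
  rfl

theorem lap_sub {u v : ℂ → ℝ} {z : ℂ} (hu : ContDiffAt ℝ 2 u z) (hv : ContDiffAt ℝ 2 v z) :
    lap (fun y => u y - v y) z = lap u z - lap v z := by
  simp only [lap, fderiv_fderiv_sub hu hv]
  ring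

theorem lap_const_mul_add {u : ℂ → ℝ} (a b : ℝ) (z : ℂ) :
    lap (fun y => a * u y + b) z = a * lap u z := by
  have h (d w : ℂ) (f : ℂ → ℝ) : fderiv ℝ (fun y => a * f y) w d = a * fderiv ℝ f w d := by
    change fderiv ℝ (a • f) w d = _
    rw [fderiv_const_smul_field]
    rfl
  simp only [lap, fderiv_add_const, h]
  ring

/-- The second derivative in any direction is nonpositive at a local maximum. -/
theorem fderiv_fderiv_nonpos_of_isLocalMax {f : ℂ → ℝ} {z : ℂ} (hf : ContDiffAt ℝ 2 f z)
    (hmax : IsLocalMax f z) (d : ℂ) : fderiv ℝ (fun w => fderiv ℝ f w d) z d ≤ 0 := by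
  by_contra! hpos
  let l : ℝ → ℂ := fun t => z + t • d
  have hl (t : ℝ) : HasDerivAt l d t := by
    simpa [l] using ((hasDerivAt_id t).smul_const d).const_add z
  have hl0 : l 0 = z := by simp [l]
  have hlt : Tendsto l (𝓝 0) (𝓝 z) := by
    simpa [hl0] using (hl 0).continuousAt.tendsto
  have hd1 : deriv (f ∘ l) =ᶠ[𝓝 0] fun t => fderiv ℝ f (l t) d := by
    filter_upwards [hlt.eventually (eventually_differentiableAt hf)] with t ht
    exact (ht.hasFDerivAt.comp_hasDerivAt t (hl t)).deriv
  have hd2 : deriv (deriv (f ∘ l)) 0 = fderiv ℝ (fun w => fderiv ℝ f w d) z d := by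
    rw [hd1.deriv_eq]
    have h := differentiableAt_fderiv_apply hf d
    rw [← hl0] at h
    have h2 := (h.hasFDerivAt.comp_hasDerivAt (0 : ℝ) (hl 0)).deriv
    rw [hl0] at h2
    exact h2
  have hmax' : IsLocalMax (f ∘ l) 0 := by
    have := hlt.eventually hmax
    filter_upwards [this] with t ht
    simpa [hl0] using ht
  have hmin : IsLocalMin (f ∘ l) 0 := by
    refine isLocalMin_of_deriv_deriv_pos (by rwa [hd2]) hmax'.deriv_eq_zero ?_
    refine ContinuousAt.comp ?_ (hl 0).continuousAt
    rw [hl0]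
    exact hf.continuousAt
  have hconst : f ∘ l =ᶠ[𝓝 0] fun _ => (f ∘ l) 0 := by
    filter_upwards [hmax', hmin] with t h1 h2
    exact le_antisymm h1 h2
  have h0 : deriv (deriv (f ∘ l)) 0 = 0 := by
    rw [hconst.deriv.deriv_eq]
    simp
  rw [hd2] at h0
  exact hpos.ne' h0

theorem lap_nonpos_of_isLocalMax {f : ℂ → ℝ} {z : ℂ} (hf : ContDiffAt ℝ 2 f z)
    (hmax : IsLocalMax f z) : lap f z ≤ 0 :=
  add_nonpos (fderiv_fderiv_nonpos_of_isLocalMax hf hmax 1)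
    (fderiv_fderiv_nonpos_of_isLocalMax hf hmax Complex.I)

/-- Comparison principle: a subsolution of Liouville's equation lies below a supersolution if it
does so near the boundary. -/
theorem liouville_comparison {D : Set ℂ} (hD : IsOpen D) (hb : Bornology.IsBounded D)
    {u w : ℂ → ℝ} (hu : ContDiffOn ℝ 2 u D) (hw : ContDiffOn ℝ 2 w D)
    (hsub : ∀ z ∈ D, Real.exp (2 * u z) ≤ lap u z)
    (hsup : ∀ z ∈ D, lap w z ≤ Real.exp (2 * w z))
    (hfr : ∀ p ∈ frontier D, ∀ᶠ z in 𝓝[D] p, u z ≤ w z) : ∀ z ∈ D, u z ≤ w z := by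
  intro z₁ hz₁
  by_contra! hlt
  have hcont : ContinuousOn (fun z => u z - w z) D := hu.continuousOn.sub hw.continuousOn
  have hcpt := isCompact_superlevel hD hb hcont (δ := u z₁ - w z₁)
    fun p hp => (hfr p hp).mono fun z hz => by linarith
  obtain ⟨z, hz, hzmax⟩ := hcpt.exists_isMaxOn ⟨z₁, hz₁, le_rfl⟩ (hcont.mono (sep_subset _ _))
  have hmax : IsLocalMax (fun z => u z - w z) z := by
    filter_upwards [hD.mem_nhds hz.1] with y hy
    by_cases h : u z₁ - w z₁ ≤ u y - w y
    · exact hzmax ⟨hy, h⟩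
    · exact (not_le.1 h).le.trans hz.2
  have hu' := hu.contDiffAt (hD.mem_nhds hz.1)
  have hw' := hw.contDiffAt (hD.mem_nhds hz.1)
  have h1 := lap_nonpos_of_isLocalMax (hu'.sub hw') hmax
  rw [lap_sub hu' hw'] at h1
  have h2 := hsub z hz.1
  have h3 := hsup z hz.1
  have h4 : Real.exp (2 * w z) < Real.exp (2 * u z) := by
    rw [Real.exp_lt_exp]
    have := hz.2
    linarith
  linarith

theorem lap_eq_of_hasFDerivAt {u p q : ℂ → ℝ} {z : ℂ} {P Q : ℂ →L[ℝ] ℝ}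
    (hu : ∀ᶠ w in 𝓝 z, HasFDerivAt u (p w • Complex.reCLM + q w • Complex.imCLM) w)
    (hp : HasFDerivAt p P z) (hq : HasFDerivAt q Q z) : lap u z = P 1 + Q Complex.I := by
  have h1 : (fun w => fderiv ℝ u w 1) =ᶠ[𝓝 z] p := hu.mono fun w hw => by simp [hw.fderiv]
  have h2 : (fun w => fderiv ℝ u w Complex.I) =ᶠ[𝓝 z] q :=
    hu.mono fun w hw => by simp [hw.fderiv]
  rw [lap, h1.fderiv_eq, h2.fderiv_eq, hp.fderiv, hq.fderiv]

/-- The logarithm of the Poincaré density of curvature `-1` on the disc of center `a` and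
radius `r`. -/
noncomputable def discSolution (a : ℂ) (r : ℝ) (z : ℂ) : ℝ :=
  Real.log (2 * r) - Real.log (r ^ 2 - ((z - a).re ^ 2 + (z - a).im ^ 2))

theorem sq_re_add_sq_im_lt {a z : ℂ} {r : ℝ} (hz : z ∈ Metric.ball a r) :
    0 < r ^ 2 - ((z - a).re ^ 2 + (z - a).im ^ 2) := by
  have h : ‖z - a‖ < r := by simpa [dist_eq_norm] using hz
  have h2 := Complex.sq_norm (z - a)
  rw [Complex.normSq_apply] at h2
  nlinarith [norm_nonneg (z - a)]

theorem hasFDerivAt_sub_re (a w : ℂ) :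
    HasFDerivAt (fun y : ℂ => (y - a).re) Complex.reCLM w :=
  Complex.reCLM.hasFDerivAt.comp w ((hasFDerivAt_id w).sub_const a)

theorem hasFDerivAt_sub_im (a w : ℂ) :
    HasFDerivAt (fun y : ℂ => (y - a).im) Complex.imCLM w :=
  Complex.imCLM.hasFDerivAt.comp w ((hasFDerivAt_id w).sub_const a)

theorem contDiffOn_discSolution (a : ℂ) (r : ℝ) :
    ContDiffOn ℝ 2 (discSolution a r) (Metric.ball a r) := by
  have hre : ContDiff ℝ 2 fun y : ℂ => (y - a).re :=
    Complex.reCLM.contDiff.comp (contDiff_id.sub contDiff_const)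
  have him : ContDiff ℝ 2 fun y : ℂ => (y - a).im :=
    Complex.imCLM.contDiff.comp (contDiff_id.sub contDiff_const)
  exact contDiffOn_const.sub
    ((contDiff_const.sub ((hre.pow 2).add (him.pow 2))).contDiffOn.log
      fun z hz => (sq_re_add_sq_im_lt hz).ne')

theorem lap_discSolution {a z : ℂ} {r : ℝ} (hr : 0 < r) (hz : z ∈ Metric.ball a r) :
    lap (discSolution a r) z = Real.exp (2 * discSolution a r z) := by
  let g : ℂ → ℝ := fun y => r ^ 2 - ((y - a).re ^ 2 + (y - a).im ^ 2)
  have hg (w : ℂ) : HasFDerivAt g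
      (-((2 * (w - a).re) • Complex.reCLM + (2 * (w - a).im) • Complex.imCLM)) w := by
    have h := (((hasFDerivAt_sub_re a w).pow 2).add
      ((hasFDerivAt_sub_im a w).pow 2)).const_sub (r ^ 2)
    refine h.congr_fderiv ?_
    ext d
    simp
  have hgpos : 0 < g z := sq_re_add_sq_im_lt hz
  rw [lap_eq_of_hasFDerivAt (p := fun w => 2 * (w - a).re * (g w)⁻¹)
    (q := fun w => 2 * (w - a).im * (g w)⁻¹) ?_
    (((hasFDerivAt_sub_re a z).const_mul 2).mul
      ((hasDerivAt_inv hgpos.ne').comp_hasFDerivAt z (hg z)))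
    (((hasFDerivAt_sub_im a z).const_mul 2).mul
      ((hasDerivAt_inv hgpos.ne').comp_hasFDerivAt z (hg z)))]
  · have hexp : Real.exp (2 * discSolution a r z) = (2 * r / g z) ^ 2 := by
      have : discSolution a r z = Real.log (2 * r / g z) := by
        rw [Real.log_div (by positivity) hgpos.ne']
        rfl
      rw [this, mul_comm, Real.exp_mul, Real.exp_log (by positivity)]
      norm_cast
    rw [hexp]
    have hr2 : r ^ 2 = g z + ((z - a).re ^ 2 + (z - a).im ^ 2) := by simp [g]
    simp
    field_simp
    rw [hr2]
    simp only [Complex.sub_re, Complex.sub_im]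
    ring
  · filter_upwards [Metric.isOpen_ball.mem_nhds hz] with w hw
    have hgw : g w ≠ 0 := (sq_re_add_sq_im_lt hw).ne'
    refine (((hg w).log hgw).const_sub (Real.log (2 * r))).congr_fderiv ?_
    ext d
    simp
    ring

/-- Interior upper bound for solutions of Liouville's equation. -/
theorem le_log_of_closedBall_subset {Ω : Set ℂ} {u : ℂ → ℝ}
    (hu : ContDiffOn ℝ 2 u Ω) (heq : ∀ z ∈ Ω, lap u z = Real.exp (2 * u z)) {a : ℂ} {r : ℝ}
    (hr : 0 < r) (hsub : Metric.closedBall a r ⊆ Ω) : u a ≤ Real.log 2 - Real.log r := by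
  obtain ⟨M, hM⟩ := (isCompact_closedBall a r).bddAbove_image (hu.continuousOn.mono hsub)
  have hball := Metric.ball_subset_closedBall.trans hsub
  have h := liouville_comparison Metric.isOpen_ball Metric.isBounded_ball (hu.mono hball)
    (contDiffOn_discSolution a r) (fun z hz => (heq z (hball hz)).ge)
    (fun z hz => (lap_discSolution hr hz).le) ?_ a (Metric.mem_ball_self hr)
  · refine h.trans (le_of_eq ?_)
    simp only [discSolution, sub_self, Complex.zero_re, Complex.zero_im]
    rw [Real.log_mul two_ne_zero hr.ne']
    simp
    ring
  · intro p hp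
    rw [frontier_ball a hr.ne'] at hp
    have hg0 : Tendsto (fun z : ℂ => r ^ 2 - ((z - a).re ^ 2 + (z - a).im ^ 2))
        (𝓝[Metric.ball a r] p) (𝓝[>] 0) := by
      refine tendsto_nhdsWithin_iff.2 ⟨?_, ?_⟩
      · have hc : Continuous fun z : ℂ => r ^ 2 - ((z - a).re ^ 2 + (z - a).im ^ 2) := by
          fun_prop
        have h0 : r ^ 2 - ((p - a).re ^ 2 + (p - a).im ^ 2) = 0 := by
          have h2 := Complex.sq_norm (p - a)
          rw [Complex.normSq_apply, ← dist_eq_norm, Metric.mem_sphere.1 hp] at h2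
          linarith
        rw [← h0]
        exact hc.continuousAt.tendsto.mono_left nhdsWithin_le_nhds
      · filter_upwards [self_mem_nhdsWithin] with z hz using sq_re_add_sq_im_lt hz
    filter_upwards [(Real.tendsto_log_nhdsGT_zero.comp hg0).eventually_le_atBot
      (Real.log (2 * r) - M), self_mem_nhdsWithin] with z h1 h2
    have h3 := hM (mem_image_of_mem u (Metric.ball_subset_closedBall h2))
    simp only [Function.comp_apply] at h1
    simp only [discSolution]
    linarith

/-- A solution of Liouville's equation on the plane slit along the ray from `q` in direction `e`,
bounded away from `q`: the pullback of the half-plane metric by a fourth root. -/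
noncomputable def slitSolution (q e : ℂ) (z : ℂ) : ℝ :=
  -Real.log 4 - (Complex.log (-e⁻¹ * (z - q))).re
    - Real.log (Real.cos ((Complex.log (-e⁻¹ * (z - q))).im / 4))

theorem cos_log_im_div_four_ge (ζ : ℂ) :
    Real.sqrt 2 / 2 ≤ Real.cos ((Complex.log ζ).im / 4) := by
  rw [← Real.cos_pi_div_four, ← Real.cos_abs ((Complex.log ζ).im / 4), Complex.log_im]
  have h := Complex.abs_arg_le_pi ζ
  have h4 : |ζ.arg / 4| = |ζ.arg| / 4 := by rw [abs_div]; norm_num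
  have hpi := Real.pi_pos
  refine Real.cos_le_cos_of_nonneg_of_le_pi (abs_nonneg _) (by linarith) ?_
  rw [h4]
  linarith

theorem cos_log_im_div_four_pos (ζ : ℂ) : 0 < Real.cos ((Complex.log ζ).im / 4) :=
  lt_of_lt_of_le (by positivity) (cos_log_im_div_four_ge ζ)

theorem log_re_rotate {e : ℂ} (he : ‖e‖ = 1) (q z : ℂ) :
    (Complex.log (-e⁻¹ * (z - q))).re = Real.log ‖z - q‖ := by
  rw [Complex.log_re, norm_mul, norm_neg, norm_inv, he, inv_one, one_mul]

theorem le_slitSolution {e : ℂ} (he : ‖e‖ = 1) (q z : ℂ) :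
    -Real.log 4 - Real.log ‖z - q‖ ≤ slitSolution q e z := by
  rw [slitSolution, log_re_rotate he]
  have := Real.log_nonpos (cos_log_im_div_four_pos (-e⁻¹ * (z - q))).le (Real.cos_le_one _)
  linarith

theorem slitSolution_le {e : ℂ} (he : ‖e‖ = 1) (q z : ℂ) :
    slitSolution q e z ≤ - Real.log ‖z - q‖ := by
  rw [slitSolution, log_re_rotate he]
  have h := Real.log_le_log (by positivity) (cos_log_im_div_four_ge (-e⁻¹ * (z - q)))
  have h2 : -Real.log 4 ≤ Real.log (Real.sqrt 2 / 2) := by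
    rw [← Real.log_inv]
    refine Real.log_le_log (by norm_num) ?_
    have : 1 ≤ Real.sqrt 2 := Real.one_le_sqrt.2 (by norm_num)
    linarith
  linarith

theorem contDiffAt_slitSolution {q e z : ℂ} (hz : -e⁻¹ * (z - q) ∈ Complex.slitPlane) :
    ContDiffAt ℝ 2 (slitSolution q e) z := by
  have hL : ContDiffAt ℝ 2 (fun y => Complex.log (-e⁻¹ * (y - q))) z :=
    ((Complex.contDiffAt_log hz).restrict_scalars ℝ).comp z
      (contDiffAt_const.mul (contDiffAt_id.sub contDiffAt_const))
  have hre : ContDiffAt ℝ 2 (fun y => (Complex.log (-e⁻¹ * (y - q))).re) z :=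
    Complex.reCLM.contDiff.contDiffAt.comp z hL
  have him : ContDiffAt ℝ 2 (fun y => (Complex.log (-e⁻¹ * (y - q))).im) z :=
    Complex.imCLM.contDiff.contDiffAt.comp z hL
  exact (contDiffAt_const.sub hre).sub
    ((him.div_const 4).cos.log (cos_log_im_div_four_pos _).ne')

theorem lap_slitSolution {q e z : ℂ} (he : ‖e‖ = 1)
    (hz : -e⁻¹ * (z - q) ∈ Complex.slitPlane) :
    lap (slitSolution q e) z = Real.exp (2 * slitSolution q e z) := by
  have he0 : e ≠ 0 := by rintro rfl; simp at he
  let L : ℂ → ℂ := fun y => Complex.log (-e⁻¹ * (y - q))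
  let k : ℂ → ℂ := fun y => (y - q)⁻¹
  let T : ℂ → ℝ := Real.tan ∘ fun y => (L y).im / 4
  have hne {w : ℂ} (hw : -e⁻¹ * (w - q) ∈ Complex.slitPlane) : w - q ≠ 0 := by
    intro h
    rw [h, mul_zero] at hw
    exact Complex.slitPlane_ne_zero hw rfl
  have hL {w : ℂ} (hw : -e⁻¹ * (w - q) ∈ Complex.slitPlane) : HasDerivAt L (k w) w := by
    have h := (((hasDerivAt_id w).sub_const q).const_mul (-e⁻¹)).clog hw
    refine h.congr_deriv ?_
    have := hne hw
    simp only [k, id]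
    field_simp
  have hLre {w : ℂ} (hw : -e⁻¹ * (w - q) ∈ Complex.slitPlane) : HasFDerivAt (fun y => (L y).re)
      ((k w).re • Complex.reCLM - (k w).im • Complex.imCLM) w := by
    refine (Complex.reCLM.hasFDerivAt.comp w
      ((hL hw).hasFDerivAt.restrictScalars ℝ)).congr_fderiv ?_
    ext d
    simp
    ring
  have hLim {w : ℂ} (hw : -e⁻¹ * (w - q) ∈ Complex.slitPlane) : HasFDerivAt (fun y => (L y).im)
      ((k w).im • Complex.reCLM + (k w).re • Complex.imCLM) w := by
    refine (Complex.imCLM.hasFDerivAt.comp w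
      ((hL hw).hasFDerivAt.restrictScalars ℝ)).congr_fderiv ?_
    ext d
    simp
    ring
  have hLdiv {w : ℂ} (hw : -e⁻¹ * (w - q) ∈ Complex.slitPlane) :
      HasFDerivAt (fun y => (L y).im / 4)
        ((4 : ℝ)⁻¹ • ((k w).im • Complex.reCLM + (k w).re • Complex.imCLM)) w := by
    simp only [div_eq_mul_inv]
    exact (hLim hw).mul_const _
  have hk : HasDerivAt k (-(k z) ^ 2) z := by
    refine (((hasDerivAt_id z).sub_const q).inv (hne hz)).congr_deriv ?_
    simp only [k, id]
    field_simp
  have hkre : HasFDerivAt (fun y => (k y).re) _ z :=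
    Complex.reCLM.hasFDerivAt.comp z (hk.hasFDerivAt.restrictScalars ℝ)
  have hkim : HasFDerivAt (fun y => (k y).im) _ z :=
    Complex.imCLM.hasFDerivAt.comp z (hk.hasFDerivAt.restrictScalars ℝ)
  have hcos (w : ℂ) : Real.cos ((L w).im / 4) ≠ 0 := (cos_log_im_div_four_pos _).ne'
  have hT : HasFDerivAt T _ z := HasDerivAt.comp_hasFDerivAt (h₂ := Real.tan)
    (f := fun y => (L y).im / 4) z (Real.hasDerivAt_tan (hcos z)) (hLdiv hz)
  rw [lap_eq_of_hasFDerivAt (p := fun w => 4⁻¹ * (T w * (k w).im) - (k w).re)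
    (q := fun w => 4⁻¹ * (T w * (k w).re) + (k w).im) ?_
    (((hT.mul hkim).const_mul 4⁻¹).sub hkre) (((hT.mul hkre).const_mul 4⁻¹).add hkim)]
  · set c := Real.cos ((L z).im / 4) with hc
    have hexp : Real.exp (2 * slitSolution q e z) = (4 * ‖z - q‖ * c)⁻¹ ^ 2 := by
      have hn : ‖z - q‖ ≠ 0 := norm_ne_zero_iff.2 (hne hz)
      have hcpos : 0 < c := cos_log_im_div_four_pos _
      have : slitSolution q e z = Real.log (4 * ‖z - q‖ * c)⁻¹ := by
        rw [Real.log_inv, Real.log_mul (by positivity) hcpos.ne',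
          Real.log_mul (by norm_num) hn, slitSolution, log_re_rotate he]
        simp only [hc, L]
        ring
      rw [this, mul_comm, Real.exp_mul, Real.exp_log (by positivity)]
      norm_cast
    have hksq : (k z).re ^ 2 + (k z).im ^ 2 = (‖z - q‖⁻¹) ^ 2 := by
      rw [← norm_inv, Complex.sq_norm, Complex.normSq_apply]
      simp only [k]
      ring
    rw [hexp]
    have hr : (4 * ‖z - q‖ * c)⁻¹ ^ 2 = 16⁻¹ * (c⁻¹) ^ 2 * (‖z - q‖⁻¹) ^ 2 := by
      rw [mul_inv, mul_inv]
      ring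
    rw [hr, ← hksq]
    simp [pow_two]
    ring
  · have hcont : ContinuousAt (fun w => -e⁻¹ * (w - q)) z := by fun_prop
    filter_upwards [hcont.eventually (Complex.isOpen_slitPlane.mem_nhds hz)] with w hw
    have h1 := (hLdiv hw).cos.log (hcos w)
    refine (((hLre hw).const_sub (-Real.log 4)).sub h1).congr_fderiv ?_
    ext d
    simp [T, Real.tan_eq_sin_div_cos]
    ring

theorem abs_realInner_le (a : ℂ) {e : ℂ} (he : ‖e‖ = 1) : |realInner a e| ≤ ‖a‖ := by
  have h : realInner a e = (a * (starRingEnd ℂ) e).re := by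
    simp [realInner]
  rw [h]
  refine (Complex.abs_re_le_norm _).trans ?_
  rw [norm_mul, Complex.norm_conj, he, mul_one]

theorem realInner_self {e : ℂ} (he : ‖e‖ = 1) : realInner e e = 1 := by
  have h := Complex.sq_norm e
  rw [he, Complex.normSq_apply] at h
  rw [realInner]
  linarith

/-- A finite cone contains balls, of radius proportional to the distance from the vertex, around
points of its axis. -/
theorem mem_finiteCone_of_norm_le {p e x : ℂ} {h θ₀ t : ℝ} (he : ‖e‖ = 1)
    (hc : 0 < Real.cos θ₀) (ht : 0 < t) (hth : 2 * t ≤ h)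
    (hx : ‖x‖ * (1 + Real.cos θ₀) ≤ t * (1 - Real.cos θ₀)) :
    p + t • e + x ∈ finiteCone p e h θ₀ := by
  set y : ℂ := t • e + x with hy
  have hxt : ‖x‖ < t := by nlinarith [norm_nonneg x]
  have hte : ‖t • e‖ = t := by rw [norm_smul, he, mul_one, Real.norm_of_nonneg ht.le]
  have hyle : ‖y‖ ≤ t + ‖x‖ := by
    rw [← hte]
    exact norm_add_le _ _
  have hinner : realInner y e = t + realInner x e := by
    have : realInner y e = t * realInner e e + realInner x e := by
      simp [realInner, hy]
      ring
    rw [this, realInner_self he, mul_one]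
  have hxe := neg_le_of_abs_le (abs_realInner_le x he)
  have hypos : 0 < ‖y‖ := by
    have := (le_abs_self _).trans (abs_realInner_le y he)
    linarith
  refine ⟨‖y‖, ‖y‖⁻¹ • y, hypos.le, by linarith, ?_, ?_, ?_⟩
  · rw [norm_smul, norm_inv, norm_norm, inv_mul_cancel₀ hypos.ne']
  · have : realInner (‖y‖⁻¹ • y) e = ‖y‖⁻¹ * realInner y e := by
      simp [realInner]
      ring
    rw [this, inv_mul_eq_div, le_div_iff₀ hypos, hinner]
    nlinarith
  · rw [smul_inv_smul₀ hypos.ne', hy, add_assoc]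

theorem axis_mem_finiteCone {p e : ℂ} {h θ₀ t : ℝ} (he : ‖e‖ = 1) (ht : 0 ≤ t) (hth : t ≤ h) :
    p + t • e ∈ finiteCone p e h θ₀ :=
  ⟨t, e, ht, hth, he, by rw [realInner_self he]; exact Real.cos_le_one _, rfl⟩

theorem rotate_mem_slitPlane {Ω : Set ℂ} {p e z : ℂ} {h θ₀ t : ℝ} (he : ‖e‖ = 1) (ht : 0 ≤ t)
    (hdisj : finiteCone p e h θ₀ ∩ Ω = ∅) (hz : z ∈ Ω) (hzp : ‖z - p‖ ≤ h) :
    -e⁻¹ * (z - (p + t • e)) ∈ Complex.slitPlane := by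
  by_contra hn
  rw [Complex.mem_slitPlane_iff, not_or, not_lt, not_not] at hn
  have he0 : e ≠ 0 := by rintro rfl; simp at he
  set ζ := -e⁻¹ * (z - (p + t • e)) with hζ
  have hζre : ζ = (ζ.re : ℂ) := by
    apply Complex.ext <;> simp [hn.2]
  have hzeq : z = p + (t - ζ.re) • e := by
    have h1 : z = p + t • e - ζ * e := by
      rw [hζ]
      field_simp
      ring
    rw [sub_smul, Complex.real_smul (x := ζ.re), ← hζre, h1]
    ring
  have hnonneg : 0 ≤ t - ζ.re := by linarith [hn.1]
  have hmem : z ∈ finiteCone p e h θ₀ := by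
    have hle : t - ζ.re ≤ h := by
      have : ‖z - p‖ = t - ζ.re := by
        conv_lhs => rw [hzeq]
        rw [add_sub_cancel_left, norm_smul, he, mul_one, Real.norm_of_nonneg hnonneg]
      linarith
    rw [hzeq]
    exact axis_mem_finiteCone he hnonneg hle
  exact (hdisj ▸ (⟨hmem, hz⟩ : z ∈ finiteCone p e h θ₀ ∩ Ω) : z ∈ (∅ : Set ℂ))

theorem lap_sub_const (u : ℂ → ℝ) (C : ℝ) (z : ℂ) : lap (fun y => u y - C) z = lap u z := by
  simp only [lap, fderiv_sub_const]

/-- Lower bound near a boundary point for a solution of Liouville's equation blowing up at the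
boundary. -/
theorem neg_log_le_of_exterior_cone {Ω : Set ℂ} (hΩ : IsOpen Ω) {v : ℂ → ℝ}
    (hv : ContDiffOn ℝ 2 v Ω) (heq : ∀ z ∈ Ω, lap v z = Real.exp (2 * v z))
    (hblow : ∀ p ∈ frontier Ω, Tendsto v (𝓝[Ω] p) atTop) {K : ℝ} (hK : ∀ z ∈ Ω, -K ≤ v z)
    {h θ₀ : ℝ} (hh : 0 < h) (hc : 0 < Real.cos θ₀) (hc1 : Real.cos θ₀ < 1) {p e : ℂ}
    (he : ‖e‖ = 1) (hp : p ∉ Ω) (hdisj : finiteCone p e h θ₀ ∩ Ω = ∅) {z : ℂ} (hz : z ∈ Ω)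
    (hzp : ‖z - p‖ < h / 2) :
    -Real.log 4 - Real.log 2 - Real.log ‖z - p‖ - max 0 (K - Real.log (h / 8)) ≤ v z := by
  set C := max 0 (K - Real.log (h / 8))
  have hzp0 : 0 < ‖z - p‖ := by
    rw [norm_pos_iff, sub_ne_zero]
    rintro rfl
    exact hp hz
  set t := min (h / 4) ‖z - p‖
  have ht : 0 < t := lt_min (by positivity) hzp0
  have hth : t ≤ h / 4 := min_le_left _ _
  set q := p + t • e with hq
  have hqp : ‖q - p‖ = t := by
    rw [hq, add_sub_cancel_left, norm_smul, he, mul_one, Real.norm_of_nonneg ht.le]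
  set ρ := t * (1 - Real.cos θ₀) / (1 + Real.cos θ₀) with hρ
  have hρpos : 0 < ρ := div_pos (mul_pos ht (by linarith)) (by linarith)
  have hfar {y : ℂ} (hy : y ∈ Ω) : ρ ≤ ‖y - q‖ := by
    by_contra! hlt
    have hmem := mem_finiteCone_of_norm_le (p := p) (e := e) (x := y - q) (h := h) he hc ht
      (by linarith) ((le_div_iff₀ (by linarith)).1 hlt.le)
    rw [← hq, add_sub_cancel] at hmem
    exact (hdisj ▸ (⟨hmem, hy⟩ : y ∈ finiteCone p e h θ₀ ∩ Ω) : y ∈ (∅ : Set ℂ))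
  have hslit {y : ℂ} (hy : y ∈ Ω ∩ Metric.ball p (h / 2)) :
      -e⁻¹ * (y - q) ∈ Complex.slitPlane := by
    have := Metric.mem_ball.1 hy.2
    rw [dist_eq_norm] at this
    exact rotate_mem_slitPlane he ht.le hdisj hy.1 (by linarith)
  have hDopen : IsOpen (Ω ∩ Metric.ball p (h / 2)) := hΩ.inter Metric.isOpen_ball
  have hcomp := liouville_comparison hDopen
    (Metric.isBounded_ball.subset inter_subset_right) (u := fun y => slitSolution q e y - C)
    (w := v)
    (fun y hy => ((contDiffAt_slitSolution (hslit hy)).sub contDiffAt_const).contDiffWithinAt)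
    (hv.mono inter_subset_left) (fun y hy => ?_) (fun y hy => (heq y hy.1).le) ?_ z
    ⟨hz, by rwa [Metric.mem_ball, dist_eq_norm]⟩
  · have h1 := le_slitSolution he q z
    have h2 : ‖z - q‖ ≤ 2 * ‖z - p‖ := by
      have h3 := norm_sub_le_norm_sub_add_norm_sub z p q
      rw [norm_sub_rev p q, hqp] at h3
      have : t ≤ ‖z - p‖ := min_le_right _ _
      linarith
    have h4 := Real.log_le_log (hρpos.trans_le (hfar hz)) h2
    rw [Real.log_mul two_ne_zero hzp0.ne'] at h4
    linarith
  · rw [lap_sub_const, lap_slitSolution he (hslit hy), Real.exp_le_exp]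
    have : 0 ≤ C := le_max_left _ _
    linarith
  · intro p' hp'
    rw [hDopen.frontier_eq] at hp'
    by_cases hp'Ω : p' ∈ Ω
    · have hdist : 3 * h / 8 < dist p' p := by
        by_contra! hlt
        exact hp'.2 ⟨hp'Ω, Metric.mem_ball.2 (by linarith)⟩
      have hev : ∀ᶠ y in 𝓝 p', 3 * h / 8 < dist y p :=
        (continuous_id.dist continuous_const).continuousAt.eventually_const_lt hdist
      filter_upwards [hev.filter_mono nhdsWithin_le_nhds, self_mem_nhdsWithin] with y hy hyD
      have h1 := slitSolution_le he q y
      have h2 : h / 8 ≤ ‖y - q‖ := by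
        have h3 := norm_sub_le_norm_sub_add_norm_sub y q p
        rw [hqp] at h3
        rw [dist_eq_norm] at hy
        linarith
      have h4 := Real.log_le_log (by positivity) h2
      have h5 : K - Real.log (h / 8) ≤ C := le_max_right _ _
      have h6 := hK y hyD.1
      linarith
    · have hfr : p' ∈ frontier Ω := by
        rw [hΩ.frontier_eq]
        exact ⟨closure_mono inter_subset_left hp'.1, hp'Ω⟩
      have htend : Tendsto v (𝓝[Ω ∩ Metric.ball p (h / 2)] p') atTop :=
        (hblow p' hfr).mono_left (nhdsWithin_mono p' inter_subset_left)
      filter_upwards [htend.eventually_ge_atTop (-Real.log ρ), self_mem_nhdsWithin] with y hy hyD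
      have h1 := slitSolution_le he q y
      have h2 := Real.log_le_log hρpos (hfar hyD.1)
      have h3 : 0 ≤ C := le_max_left _ _
      linarith

theorem exists_forall_neg_le {Ω : Set ℂ} (hΩ : IsOpen Ω) (hb : Bornology.IsBounded Ω) {v : ℂ → ℝ}
    (hv : ContinuousOn v Ω) (hblow : ∀ p ∈ frontier Ω, Tendsto v (𝓝[Ω] p) atTop) :
    ∃ K : ℝ, ∀ z ∈ Ω, -K ≤ v z := by
  have hcpt := isCompact_superlevel hΩ hb hv.neg (δ := 0) fun p hp =>
    ((hblow p hp).eventually_gt_atTop 0).mono fun z hz => neg_neg_of_pos hz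
  obtain ⟨M, hM⟩ := hcpt.bddAbove_image (hv.neg.mono (sep_subset _ _))
  refine ⟨max 0 M, fun z hz => ?_⟩
  have h0 := le_max_left 0 M
  have h1 := le_max_right 0 M
  by_cases h : 0 ≤ -v z
  · have := hM (mem_image_of_mem _ (⟨hz, h⟩ : z ∈ {z ∈ Ω | 0 ≤ (-v) z}))
    simp only [Pi.neg_apply] at this
    linarith
  · linarith

/-- Near the boundary, two solutions blowing up there differ by a bounded amount. -/
theorem exists_eventually_le_add {Ω : Set ℂ} (hΩ : IsOpen Ω) {h θ₀ : ℝ} (hh : 0 < h)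
    (hc : 0 < Real.cos θ₀) (hc1 : Real.cos θ₀ < 1) (hcone : UnifExtCone Ω h θ₀) {u v : ℂ → ℝ}
    (hu : ContDiffOn ℝ 2 u Ω) (hv : ContDiffOn ℝ 2 v Ω)
    (hueq : ∀ z ∈ Ω, lap u z = Real.exp (2 * u z)) (hveq : ∀ z ∈ Ω, lap v z = Real.exp (2 * v z))
    (hvblow : ∀ p ∈ frontier Ω, Tendsto v (𝓝[Ω] p) atTop) {K : ℝ} (hK : ∀ z ∈ Ω, -K ≤ v z) :
    ∃ C : ℝ, ∀ p ∈ frontier Ω, ∀ᶠ z in 𝓝[Ω] p, u z ≤ v z + C := by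
  refine ⟨2 * Real.log 2 + Real.log 4 + Real.log 2 + max 0 (K - Real.log (h / 8)),
    fun p hp => ?_⟩
  have hpΩ : p ∉ Ω := by
    rw [hΩ.frontier_eq] at hp
    exact hp.2
  have hev : ∀ᶠ z in 𝓝[Ω] p, dist z p < h / 2 :=
    nhdsWithin_le_nhds (Metric.ball_mem_nhds p (by positivity))
  filter_upwards [hev, self_mem_nhdsWithin] with z hzp hz
  obtain ⟨p', hp', hdist⟩ := exists_mem_frontier_infDist_compl_eq_dist hz
    fun h : Ω = univ => hpΩ (h ▸ mem_univ p)
  have hp'Ω : p' ∉ Ω := by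
    rw [hΩ.frontier_eq] at hp'
    exact hp'.2
  obtain ⟨e, he, hdisj⟩ := hcone p' hp'
  have hle : dist z p' ≤ dist z p := by
    rw [← hdist]
    exact Metric.infDist_le_dist_of_mem hpΩ
  have hpos : 0 < ‖z - p'‖ := by
    rw [norm_pos_iff, sub_ne_zero]
    rintro rfl
    exact hp'Ω hz
  have hlow := neg_log_le_of_exterior_cone hΩ hv hveq hvblow hK hh hc hc1 he hp'Ω hdisj hz
    (by rw [← dist_eq_norm]; linarith)
  have hup := le_log_of_closedBall_subset hu hueq (a := z) (r := ‖z - p'‖ / 2) (by positivity) (by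
    intro y hy
    by_contra hyΩ
    have h1 := Metric.infDist_le_dist_of_mem (x := z) (show y ∈ Ωᶜ from hyΩ)
    rw [hdist, dist_comm z y, dist_eq_norm] at h1
    have h2 := Metric.mem_closedBall.1 hy
    linarith)
  rw [Real.log_div hpos.ne' two_ne_zero] at hup
  linarith

theorem liouville_le {Ω : Set ℂ} (hΩ : IsOpen Ω) (hb : Bornology.IsBounded Ω) {h θ₀ : ℝ}
    (hh : 0 < h) (hc : 0 < Real.cos θ₀) (hc1 : Real.cos θ₀ < 1) (hcone : UnifExtCone Ω h θ₀)
    {u v : ℂ → ℝ} (hu : ContDiffOn ℝ 2 u Ω) (hv : ContDiffOn ℝ 2 v Ω)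
    (hueq : ∀ z ∈ Ω, lap u z = Real.exp (2 * u z)) (hveq : ∀ z ∈ Ω, lap v z = Real.exp (2 * v z))
    (hvblow : ∀ p ∈ frontier Ω, Tendsto v (𝓝[Ω] p) atTop) : ∀ z ∈ Ω, u z ≤ v z := by
  obtain ⟨K, hK⟩ := exists_forall_neg_le hΩ hb hv.continuousOn hvblow
  obtain ⟨C, hC⟩ := exists_eventually_le_add hΩ hh hc hc1 hcone hu hv hueq hveq hvblow hK
  have hε : ∀ ε > 0, ∀ z ∈ Ω, u z ≤ (1 + ε) * v z + ε * (K + 1) := by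
    intro ε hε
    refine liouville_comparison hΩ hb hu ((contDiffOn_const.mul hv).add contDiffOn_const)
      (fun z hz => (hueq z hz).ge) (fun z hz => ?_) fun p hp => ?_
    · rw [lap_const_mul_add, hveq z hz]
      have h1 : 1 + ε ≤ Real.exp ε := by linarith [Real.add_one_le_exp ε]
      calc (1 + ε) * Real.exp (2 * v z) ≤ Real.exp ε * Real.exp (2 * v z) := by gcongr
        _ = Real.exp (ε + 2 * v z) := (Real.exp_add _ _).symm
        _ ≤ _ := by
          rw [Real.exp_le_exp]
          nlinarith [hK z hz]
    · filter_upwards [hC p hp, (hvblow p hp).eventually_ge_atTop (C / ε - (K + 1))] with z h1 h2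
      have h3 : C ≤ (v z + (K + 1)) * ε := (div_le_iff₀ hε).1 (by linarith)
      linarith
  intro z hz
  have hlim : Tendsto (fun ε : ℝ => (1 + ε) * v z + ε * (K + 1)) (𝓝[>] 0) (𝓝 (v z)) := by
    have hcont : Continuous fun ε : ℝ => (1 + ε) * v z + ε * (K + 1) := by fun_prop
    simpa using (hcont.tendsto 0).mono_left (nhdsWithin_le_nhds (s := Ioi 0))
  exact ge_of_tendsto hlim (eventually_mem_nhdsWithin.mono fun ε h => hε ε h z hz)

/-- Theorem 2.2, uniqueness: in a bounded domain satisfying a uniform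
exterior cone condition, the solution of Liouville's equation blowing up at the
boundary is unique. -/
theorem liouville_uniqueness (Ω : Set ℂ) (hΩopen : IsOpen Ω) (hΩconn : IsConnected Ω)
    (hΩbdd : Bornology.IsBounded Ω)
    (h θ₀ : ℝ) (hh : 0 < h) (hθ₀ : 0 < θ₀) (hθ₀' : θ₀ < Real.pi / 2)
    (hcone : UnifExtCone Ω h θ₀)
    (u v : ℂ → ℝ) (hureg : ContDiffOn ℝ (⊤ : ℕ∞) u Ω) (hvreg : ContDiffOn ℝ (⊤ : ℕ∞) v Ω)
    (hueq : ∀ z ∈ Ω, lap u z = Real.exp (2 * u z))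
    (hveq : ∀ z ∈ Ω, lap v z = Real.exp (2 * v z))
    (hublow : ∀ p ∈ frontier Ω, Filter.Tendsto u (nhdsWithin p Ω) Filter.atTop)
    (hvblow : ∀ p ∈ frontier Ω, Filter.Tendsto v (nhdsWithin p Ω) Filter.atTop) :
    Set.EqOn u v Ω := by
  have hcos : 0 < Real.cos θ₀ := Real.cos_pos_of_mem_Ioo ⟨by linarith, hθ₀'⟩
  have hcos1 : Real.cos θ₀ < 1 := by
    rw [← Real.cos_zero]
    exact Real.cos_lt_cos_of_nonneg_of_le_pi_div_two le_rfl hθ₀'.le hθ₀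
  have hu2 : ContDiffOn ℝ 2 u Ω := hureg.of_le (WithTop.coe_le_coe.2 le_top)
  have hv2 : ContDiffOn ℝ 2 v Ω := hvreg.of_le (WithTop.coe_le_coe.2 le_top)
  exact fun z hz => le_antisymm
    (liouville_le hΩopen hΩbdd hh hcos hcos1 hcone hu2 hv2 hueq hveq hvblow z hz)
    (liouville_le hΩopen hΩbdd hh hcos hcos1 hcone hv2 hu2 hveq hueq hublow z hz)
end

section
/- Let Ω ⊂ ℝ² be a bounded domain satisfying a uniform exterior cone condition, with Ω contained in the ball B_{1/2}(0). If u ∈ C^∞(Ω) satisfies Δu = e^{2u} in Ω and u(z) → +∞ as z → ∂Ω, then u ≥ log 4 everywhere in Ω. -/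
/-- At a local minimum the second derivative of a real function is nonnegative. -/
theorem IsLocalMin.deriv_deriv_nonneg {g : ℝ → ℝ} {x : ℝ} (hmin : IsLocalMin g x)
    (hc : ContinuousAt g x) : 0 ≤ deriv (deriv g) x := by
  by_contra! hneg
  have hmax : IsLocalMax g x := isLocalMax_of_deriv_deriv_neg hneg hmin.deriv_eq_zero hc
  have hconst : g =ᶠ[nhds x] fun _ => g x := by
    filter_upwards [hmin, hmax] with y h₁ h₂ using le_antisymm h₂ h₁
  have hzero : deriv (deriv g) x = 0 := by
    rw [hconst.deriv.deriv_eq]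
    simp
  exact hneg.ne hzero

/-- At a local minimum the second derivative in any direction is nonnegative. -/
theorem IsLocalMin.fderiv_fderiv_nonneg {E : Type*} [NormedAddCommGroup E] [NormedSpace ℝ E]
    {f : E → ℝ} {z : E} (hmin : IsLocalMin f z) (hf : ContDiffAt ℝ 2 f z) (e : E) :
    0 ≤ fderiv ℝ (fun w => fderiv ℝ f w e) z e := by
  have hline (t : ℝ) : HasDerivAt (fun t : ℝ => z + t • e) e t := by
    simpa using ((hasDerivAt_id t).smul_const e).const_add z
  have hcont : Filter.Tendsto (fun t : ℝ => z + t • e) (nhds 0) (nhds z) := by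
    simpa using (hline 0).continuousAt.tendsto
  have hdiff : ∀ᶠ w in nhds z, DifferentiableAt ℝ f w := by
    filter_upwards [hf.eventually (by simp)] with w hw using hw.differentiableAt (by simp)
  have hderiv : deriv (fun t : ℝ => f (z + t • e)) =ᶠ[nhds 0]
      fun t => fderiv ℝ f (z + t • e) e := by
    filter_upwards [hcont.eventually hdiff] with t ht
    exact (ht.hasFDerivAt.comp_hasDerivAt t (hline t)).deriv
  have hdiff₂ : DifferentiableAt ℝ (fun w => fderiv ℝ f w e) z :=
    ((hf.fderiv_right (m := 1) (by norm_num)).differentiableAt (by simp)).clm_apply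
      (differentiableAt_const e)
  have hz : z + (0 : ℝ) • e = z := by simp
  have hsecond : deriv (deriv fun t : ℝ => f (z + t • e)) 0 =
      fderiv ℝ (fun w => fderiv ℝ f w e) z e := by
    rw [hderiv.deriv_eq]
    exact (hdiff₂.hasFDerivAt.comp_hasDerivAt_of_eq 0 (hline 0) hz.symm).deriv
  rw [← hsecond]
  refine IsLocalMin.deriv_deriv_nonneg ?_ ?_
  · have := hcont.eventually hmin
    simpa [IsLocalMin, IsMinFilter] using this
  · exact hf.continuousAt.comp_of_eq (hline 0).continuousAt hz

theorem fderiv_fderiv_sub_s6 {E : Type*} [NormedAddCommGroup E] [NormedSpace ℝ E]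
    {f g : E → ℝ} {z : E} (hf : ContDiffAt ℝ 2 f z) (hg : ContDiffAt ℝ 2 g z) (e : E) :
    fderiv ℝ (fun w => fderiv ℝ (fun x => f x - g x) w e) z e =
      fderiv ℝ (fun w => fderiv ℝ f w e) z e - fderiv ℝ (fun w => fderiv ℝ g w e) z e := by
  have hsub : (fun w => fderiv ℝ (fun x => f x - g x) w e) =ᶠ[nhds z]
      fun w => fderiv ℝ f w e - fderiv ℝ g w e := by
    filter_upwards [hf.eventually (by simp), hg.eventually (by simp)] with w hfw hgw
    rw [fderiv_fun_sub (hfw.differentiableAt (by simp)) (hgw.differentiableAt (by simp))]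
    rfl
  have hdiff {k : E → ℝ} (hk : ContDiffAt ℝ 2 k z) :
      DifferentiableAt ℝ (fun w => fderiv ℝ k w e) z :=
    ((hk.fderiv_right (m := 1) (by norm_num)).differentiableAt (by simp)).clm_apply
      (differentiableAt_const e)
  rw [hsub.fderiv_eq, fderiv_fun_sub (hdiff hf) (hdiff hg)]
  rfl

/-- If `u - v` has a local minimum at `z`, then `Δv ≤ Δu` at `z`. -/
theorem lap_le_lap_of_isLocalMin_sub {u v : ℂ → ℝ} {z : ℂ} (hu : ContDiffAt ℝ 2 u z)
    (hv : ContDiffAt ℝ 2 v z) (hmin : IsLocalMin (fun w => u w - v w) z) :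
    lap v z ≤ lap u z := by
  have h₁ := hmin.fderiv_fderiv_nonneg (hu.sub hv) 1
  have h₂ := hmin.fderiv_fderiv_nonneg (hu.sub hv) Complex.I
  rw [fderiv_fderiv_sub_s6 hu hv] at h₁ h₂
  unfold lap
  linarith

/-- The logarithm of the density of the hyperbolic metric on the disc of radius `R`. -/
noncomputable def logPoincare (R : ℝ) (z : ℂ) : ℝ :=
  Real.log (2 * R) - Real.log (R ^ 2 - (z.re ^ 2 + z.im ^ 2))

theorem sq_sub_pos_of_norm_lt {R : ℝ} {z : ℂ} (hz : ‖z‖ < R) :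
    0 < R ^ 2 - (z.re ^ 2 + z.im ^ 2) := by
  have hsq : ‖z‖ ^ 2 = z.re ^ 2 + z.im ^ 2 := by
    rw [Complex.sq_norm, Complex.normSq_apply]; ring
  nlinarith [norm_nonneg z]

theorem contDiffAt_logPoincare {R : ℝ} {z : ℂ} (hz : ‖z‖ < R) :
    ContDiffAt ℝ 2 (logPoincare R) z := by
  have hre : ContDiffAt ℝ 2 (fun w : ℂ => w.re) z := Complex.reCLM.contDiff.contDiffAt
  have him : ContDiffAt ℝ 2 (fun w : ℂ => w.im) z := Complex.imCLM.contDiff.contDiffAt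
  exact contDiffAt_const.sub ((contDiffAt_const.sub ((hre.pow 2).add (him.pow 2))).log
    (sq_sub_pos_of_norm_lt hz).ne')

theorem hasFDerivAt_sq_sub (R : ℝ) (z : ℂ) :
    HasFDerivAt (fun w : ℂ => R ^ 2 - (w.re ^ 2 + w.im ^ 2))
      (-((2 * z.re) • Complex.reCLM + (2 * z.im) • Complex.imCLM)) z := by
  have hre : HasFDerivAt (fun w : ℂ => w.re) Complex.reCLM z := Complex.reCLM.hasFDerivAt
  have him : HasFDerivAt (fun w : ℂ => w.im) Complex.imCLM z := Complex.imCLM.hasFDerivAt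
  simpa using ((hre.pow 2).add (him.pow 2)).const_sub (R ^ 2)

theorem fderiv_logPoincare {R : ℝ} {z : ℂ} (hz : ‖z‖ < R) (e : ℂ) :
    fderiv ℝ (logPoincare R) z e =
      (2 * z.re * e.re + 2 * z.im * e.im) * (R ^ 2 - (z.re ^ 2 + z.im ^ 2))⁻¹ := by
  have := ((hasFDerivAt_sq_sub R z).log (sq_sub_pos_of_norm_lt hz).ne').const_sub
    (Real.log (2 * R))
  unfold logPoincare
  rw [this.fderiv]
  simp
  ring

theorem fderiv_fderiv_logPoincare {R : ℝ} {z : ℂ} (hz : ‖z‖ < R) (e : ℂ) :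
    fderiv ℝ (fun w => fderiv ℝ (logPoincare R) w e) z e =
      2 * (e.re ^ 2 + e.im ^ 2) * (R ^ 2 - (z.re ^ 2 + z.im ^ 2))⁻¹ +
        (2 * z.re * e.re + 2 * z.im * e.im) ^ 2 *
          ((R ^ 2 - (z.re ^ 2 + z.im ^ 2)) ^ 2)⁻¹ := by
  have hev : (fun w => fderiv ℝ (logPoincare R) w e) =ᶠ[nhds z] fun w =>
      (2 * w.re * e.re + 2 * w.im * e.im) * (R ^ 2 - (w.re ^ 2 + w.im ^ 2))⁻¹ := by
    filter_upwards [continuous_norm.continuousAt.eventually_lt continuousAt_const hz] with w hw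
    exact fderiv_logPoincare hw e
  have hre : HasFDerivAt (fun w : ℂ => w.re) Complex.reCLM z := Complex.reCLM.hasFDerivAt
  have him : HasFDerivAt (fun w : ℂ => w.im) Complex.imCLM z := Complex.imCLM.hasFDerivAt
  have hinv := (hasDerivAt_inv (sq_sub_pos_of_norm_lt hz).ne').comp_hasFDerivAt z
    (hasFDerivAt_sq_sub R z)
  have hnum := ((hre.const_mul 2).mul_const e.re).add ((him.const_mul 2).mul_const e.im)
  have hmul := hnum.mul hinv
  rw [hev.fderiv_eq]
  erw [hmul.fderiv]
  simp
  ring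

/-- The hyperbolic metric on a disc solves Liouville's equation. -/
theorem lap_logPoincare {R : ℝ} {z : ℂ} (hz : ‖z‖ < R) :
    lap (logPoincare R) z = Real.exp (2 * logPoincare R z) := by
  have hR : 0 < R := (norm_nonneg z).trans_lt hz
  have hpos := sq_sub_pos_of_norm_lt hz
  have hexp : Real.exp (2 * logPoincare R z) =
      (2 * R / (R ^ 2 - (z.re ^ 2 + z.im ^ 2))) ^ 2 := by
    rw [two_mul, Real.exp_add, logPoincare, Real.exp_sub, Real.exp_log (by positivity),
      Real.exp_log hpos, ← sq]
  rw [hexp, lap, fderiv_fderiv_logPoincare hz, fderiv_fderiv_logPoincare hz]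
  simp only [Complex.one_re, Complex.one_im, Complex.I_re, Complex.I_im]
  field_simp
  ring

theorem log_two_div_le_logPoincare {R : ℝ} {z : ℂ} (hz : ‖z‖ < R) :
    Real.log (2 / R) ≤ logPoincare R z := by
  have hR : 0 < R := (norm_nonneg z).trans_lt hz
  have hpos := sq_sub_pos_of_norm_lt hz
  rw [logPoincare, ← Real.log_div (by positivity) hpos.ne']
  refine Real.log_le_log (by positivity) ?_
  rw [div_le_div_iff₀ hR hpos]
  nlinarith [sq_nonneg z.re, sq_nonneg z.im]

/-- A function which is continuous on an open bounded set and tends to `+∞` at the boundary has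
a local minimum lying below any prescribed value. -/
theorem exists_isLocalMin_le_of_tendsto_atTop {E : Type*} [PseudoMetricSpace E] [ProperSpace E]
    {Ω : Set E} (hopen : IsOpen Ω) (hbdd : Bornology.IsBounded Ω) {f : E → ℝ}
    (hf : ContinuousOn f Ω)
    (hblow : ∀ p ∈ frontier Ω, Filter.Tendsto f (nhdsWithin p Ω) Filter.atTop)
    {a : E} (ha : a ∈ Ω) : ∃ z ∈ Ω, IsLocalMin f z ∧ f z ≤ f a := by
  let K := {z | z ∈ Ω ∧ f z ≤ f a}
  have hKΩ : K ⊆ Ω := fun _ hz => hz.1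
  have hclosed : IsClosed K := by
    refine isClosed_of_closure_subset fun p hp => ?_
    have hfreq : ∃ᶠ z in nhds p, z ∈ K := mem_closure_iff_frequently.1 hp
    by_contra hpK
    have hlarge : ∀ᶠ z in nhdsWithin p Ω, f a < f z := by
      by_cases hpΩ : p ∈ Ω
      · have : f a < f p := not_le.1 fun hle => hpK ⟨hpΩ, hle⟩
        exact (hf p hpΩ).eventually (lt_mem_nhds this)
      · have hfr : p ∈ frontier Ω := by
          rw [hopen.frontier_eq]
          exact ⟨closure_mono hKΩ hp, hpΩ⟩
        exact (hblow p hfr).eventually_gt_atTop (f a)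
    refine hfreq ?_
    filter_upwards [eventually_nhdsWithin_iff.1 hlarge] with z hz hzK
    exact (hz hzK.1).not_ge hzK.2
  obtain ⟨z, hz, hmin⟩ := (Metric.isCompact_of_isClosed_isBounded hclosed
    (hbdd.subset hKΩ)).exists_isMinOn ⟨a, ha, le_rfl⟩ (hf.mono hKΩ)
  refine ⟨z, hz.1, ?_, hz.2⟩
  filter_upwards [hopen.mem_nhds hz.1] with w hw
  by_cases hle : f w ≤ f a
  · exact hmin ⟨hw, hle⟩
  · exact hz.2.trans (not_le.1 hle).le

/-- A solution of Liouville's equation blowing up at the boundary dominates the hyperbolic metric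
of any larger disc. -/
theorem logPoincare_le_of_lap_eq_exp {Ω : Set ℂ} (hopen : IsOpen Ω) {r R : ℝ} (hrR : r < R)
    (hsub : Ω ⊆ Metric.ball 0 r) {u : ℂ → ℝ} (hreg : ContDiffOn ℝ 2 u Ω)
    (heq : ∀ z ∈ Ω, lap u z = Real.exp (2 * u z))
    (hblow : ∀ p ∈ frontier Ω, Filter.Tendsto u (nhdsWithin p Ω) Filter.atTop)
    {a : ℂ} (ha : a ∈ Ω) : logPoincare R a ≤ u a := by
  have hlt {z : ℂ} (hz : z ∈ closure Ω) : ‖z‖ < R := by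
    have := Metric.closure_ball_subset_closedBall (closure_mono hsub hz)
    exact (mem_closedBall_zero_iff.1 this).trans_lt hrR
  have hltΩ {z : ℂ} (hz : z ∈ Ω) : ‖z‖ < R := hlt (subset_closure hz)
  obtain ⟨z, hz, hmin, hle⟩ := exists_isLocalMin_le_of_tendsto_atTop hopen
    (Metric.isBounded_ball.subset hsub) (f := fun w => u w - logPoincare R w)
    (hreg.continuousOn.sub fun w hw =>
      (contDiffAt_logPoincare (hltΩ hw)).continuousAt.continuousWithinAt)
    (fun p hp => by
      have hv := (contDiffAt_logPoincare (hlt hp.1)).continuousAt.continuousWithinAt (s := Ω)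
      simpa only [sub_eq_add_neg, Pi.neg_apply] using (hblow p hp).atTop_add hv.neg) ha
  have hlap := lap_le_lap_of_isLocalMin_sub (hreg.contDiffAt (hopen.mem_nhds hz))
    (contDiffAt_logPoincare (hltΩ hz)) hmin
  rw [heq z hz, lap_logPoincare (hltΩ hz), Real.exp_le_exp] at hlap
  linarith

/-- if a bounded domain with a uniform exterior cone condition is
contained in the ball of radius `1/2`, then any solution of Liouville's equation
blowing up at the boundary satisfies `u ≥ log 4`. -/
theorem liouville_lower_bound_small_domain (Ω : Set ℂ) (hΩopen : IsOpen Ω)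
    (hΩconn : IsConnected Ω) (hΩbdd : Bornology.IsBounded Ω)
    (hsmall : Ω ⊆ Metric.ball 0 (1 / 2))
    (h θ₀ : ℝ) (hh : 0 < h) (hθ₀ : 0 < θ₀) (hθ₀' : θ₀ < Real.pi / 2)
    (hcone : UnifExtCone Ω h θ₀)
    (u : ℂ → ℝ) (hreg : ContDiffOn ℝ (⊤ : ℕ∞) u Ω)
    (heq : ∀ z ∈ Ω, lap u z = Real.exp (2 * u z))
    (hblow : ∀ p ∈ frontier Ω, Filter.Tendsto u (nhdsWithin p Ω) Filter.atTop) :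
    ∀ z ∈ Ω, Real.log 4 ≤ u z := by
  intro z hz
  have hlim : Filter.Tendsto (fun R : ℝ => Real.log (2 / R)) (nhdsWithin (1 / 2) (Set.Ioi (1 / 2)))
      (nhds (Real.log 4)) := by
    have hcont : ContinuousAt (fun R : ℝ => Real.log (2 / R)) (1 / 2) :=
      (continuousAt_const.div continuousAt_id (by norm_num)).log (by norm_num)
    have hval : Real.log (2 / (1 / 2)) = Real.log 4 := by norm_num
    rw [← hval]
    exact hcont.tendsto.mono_left nhdsWithin_le_nhds
  refine le_of_tendsto hlim ?_
  filter_upwards [self_mem_nhdsWithin] with R hR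
  have hzR : ‖z‖ < R := (mem_ball_zero_iff.1 (hsmall hz)).trans hR
  exact (log_two_div_le_logPoincare hzR).trans
    (logPoincare_le_of_lap_eq_exp hΩopen hR hsmall
      (contDiffOn_infty.1 hreg 2) heq hblow hz)
end

section
/- (Lemma 5.2) Let Ω₁ and Ω₂ be open subsets of ℂ, identified with subsets of ℝ². Suppose u₂ ∈ C^∞(Ω₂) satisfies Δu₂ = e^{2u₂} in Ω₂, and suppose f : Ω₁ → Ω₂ is a holomorphic bijection from Ω₁ onto Ω₂. Then the function u₁(z) = u₂(f(z)) + log |f'(z)| satisfies Δu₁ = e^{2u₁} in Ω₁. (Note that f'(z) ≠ 0 for all z ∈ Ω₁ since f is an injective holomorphic map.) -/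
open Filter Topology InnerProductSpace Laplacian

/-- A holomorphic function which is injective near a point has nonzero derivative there. -/
theorem AnalyticAt.deriv_ne_zero_of_injOn {f : ℂ → ℂ} {z₀ : ℂ} {s : Set ℂ}
    (hf : AnalyticAt ℂ f z₀) (hs : s ∈ 𝓝 z₀) (hinj : Set.InjOn f s) : deriv f z₀ ≠ 0 := by
  intro hd
  have hord := hf.analyticOrderAt_deriv_add_one
  have hd0 : analyticOrderAt (deriv f) z₀ ≠ 0 := hf.deriv.analyticOrderAt_ne_zero.2 hd
  cases hn : analyticOrderAt (f · - f z₀) z₀ with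
  | top =>
    rw [analyticOrderAt_eq_top] at hn
    obtain ⟨w, ⟨hw, hws⟩, hwne⟩ :=
      ((eventually_nhdsWithin_of_eventually_nhds (hn.and hs)).and
        (self_mem_nhdsWithin (s := {z₀}ᶜ))).exists
    exact hwne (hinj hws (mem_of_mem_nhds hs) (sub_eq_zero.1 hw))
  | coe n =>
    have hn2 : 2 ≤ n := by
      rw [hn] at hord
      cases hm : analyticOrderAt (deriv f) z₀ with
      | top => simp [hm] at hord
      | coe m =>
        rw [hm] at hord hd0
        have h1 : m + 1 = n := by exact_mod_cast hord
        have h2 : m ≠ 0 := by exact_mod_cast hd0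
        omega
    have hn0 : n ≠ 0 := by omega
    obtain ⟨g, hg, hg0, hfg⟩ :=
      (AnalyticAt.analyticOrderAt_eq_natCast (by fun_prop)).1 hn
    set k : ℂ → ℂ := fun z => (g z / g z₀) ^ ((n : ℂ)⁻¹) with hk
    have hka : AnalyticAt ℂ k z₀ :=
      (hg.div analyticAt_const hg0).cpow analyticAt_const (by simp [hg0])
    have hk0 : k z₀ = 1 := by simp [hk, hg0]
    set h : ℂ → ℂ := fun z => (z - z₀) * k z with hh
    have hha : HasStrictDerivAt h 1 z₀ := by
      have := HasStrictDerivAt.fun_mul ((hasStrictDerivAt_id z₀).sub_const z₀) hka.hasStrictDerivAt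
      simpa [hk0] using this
    have hh0 : h z₀ = 0 := by simp [hh]
    have hmap : map h (𝓝 z₀) = 𝓝 0 := by
      rw [hha.map_nhds_eq one_ne_zero, hh0]
    have hpow : ∀ z, h z ^ n = (z - z₀) ^ n * (g z / g z₀) := fun z => by
      simp only [hh, hk, mul_pow, Complex.cpow_nat_inv_pow _ hn0]
    have hT : h '' (s ∩ {z | f z - f z₀ = (z - z₀) ^ n • g z}) ∈ 𝓝 (0 : ℂ) := by
      rw [← hmap]
      exact image_mem_map (inter_mem hs hfg)
    obtain ⟨ζ, hζ⟩ : ∃ ζ : ℂ, IsPrimitiveRoot ζ n := ⟨_, Complex.isPrimitiveRoot_exp n hn0⟩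
    have hT' : ∀ᶠ w in 𝓝 (0 : ℂ),
        ζ * w ∈ h '' (s ∩ {z | f z - f z₀ = (z - z₀) ^ n • g z}) := by
      have hc : Tendsto (fun w : ℂ => ζ * w) (𝓝 0) (𝓝 0) := by
        have : Continuous (fun w : ℂ => ζ * w) := by fun_prop
        simpa using this.tendsto 0
      exact hc.eventually hT
    obtain ⟨w, ⟨⟨a, ⟨has, ha⟩, haw⟩, ⟨b, ⟨hbs, hb⟩, hbw⟩⟩, hw⟩ :=
      ((eventually_nhdsWithin_of_eventually_nhds (Filter.Eventually.and hT hT')).and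
        (self_mem_nhdsWithin (s := {(0 : ℂ)}ᶜ))).exists
    have hval : ∀ z, f z - f z₀ = (z - z₀) ^ n • g z → f z = f z₀ + g z₀ * h z ^ n := by
      intro z hz
      rw [hpow, ← sub_eq_iff_eq_add', hz, smul_eq_mul]
      field_simp
    have hab : f a = f b := by
      rw [hval a ha, hval b hb, haw, hbw, mul_pow, hζ.pow_eq_one, one_mul]
    have hwz : w = ζ * w := by rw [← hbw, ← haw, hinj has hbs hab]
    exact hζ.ne_one (by omega) (mul_right_cancel₀ hw (by rw [one_mul]; exact hwz.symm))

theorem ContDiffAt.differentiableAt_fderiv {u : ℂ → ℝ} {z : ℂ} (hu : ContDiffAt ℝ 2 u z) :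
    DifferentiableAt ℝ (fderiv ℝ u) z :=
  (hu.fderiv_right (m := 1) (by norm_num)).differentiableAt (by norm_num)

theorem lap_eq_fderiv_fderiv {u : ℂ → ℝ} {z : ℂ} (hu : ContDiffAt ℝ 2 u z) :
    lap u z = fderiv ℝ (fderiv ℝ u) z 1 1 +
      fderiv ℝ (fderiv ℝ u) z Complex.I Complex.I := by
  have hd := hu.differentiableAt_fderiv
  simp [lap, fderiv_clm_apply hd (differentiableAt_const _)]

theorem lap_eq_laplacian {u : ℂ → ℝ} {z : ℂ} (hu : ContDiffAt ℝ 2 u z) :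
    lap u z = Δ u z := by
  simp [lap_eq_fderiv_fderiv hu, laplacian_eq_iteratedFDeriv_complexPlane,
    iteratedFDeriv_two_apply]

/-- The Laplacian scales by `‖f'‖ ^ 2` under precomposition with a holomorphic map. -/
theorem lap_comp_analyticAt {u : ℂ → ℝ} {f : ℂ → ℂ} {z : ℂ} (hf : AnalyticAt ℂ f z)
    (hu : ContDiffAt ℝ 2 u (f z)) :
    lap (u ∘ f) z = ‖deriv f z‖ ^ 2 * lap u (f z) := by
  have hfd : HasFDerivAt f ((fderiv ℂ f z).restrictScalars ℝ) z :=
    hf.differentiableAt.hasFDerivAt.restrictScalars ℝ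
  have hud : ∀ᶠ w in 𝓝 z, DifferentiableAt ℝ u (f w) :=
    hf.continuousAt.eventually
      ((hu.eventually (by simp)).mono fun w hw => hw.differentiableAt (by norm_num))
  have hfst : ∀ v : ℂ, (fun w => fderiv ℝ (u ∘ f) w v) =ᶠ[𝓝 z]
      fun w => fderiv ℝ u (f w) (deriv f w * v) := by
    intro v
    filter_upwards [hud, hf.eventually_analyticAt] with w hw hfw
    have h1 : HasFDerivAt f ((fderiv ℂ f w).restrictScalars ℝ) w :=
      hfw.differentiableAt.hasFDerivAt.restrictScalars ℝ
    rw [(hw.hasFDerivAt.comp w h1).fderiv]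
    simp [mul_comm]
  have hsnd : ∀ v : ℂ, fderiv ℝ (fun w => fderiv ℝ (u ∘ f) w v) z v =
      fderiv ℝ (fderiv ℝ u) (f z) (deriv f z * v) (deriv f z * v) +
        fderiv ℝ u (f z) (deriv (deriv f) z * (v * v)) := by
    intro v
    rw [(hfst v).fderiv_eq]
    have h1 : HasFDerivAt (fun w => fderiv ℝ u (f w))
        ((fderiv ℝ (fderiv ℝ u) (f z)).comp ((fderiv ℂ f z).restrictScalars ℝ)) z :=
      hu.differentiableAt_fderiv.hasFDerivAt.comp z hfd
    have h2 : HasFDerivAt (fun w => deriv f w * v)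
        ((fderiv ℂ (fun w => deriv f w * v) z).restrictScalars ℝ) z :=
      (hf.deriv.differentiableAt.mul_const v).hasFDerivAt.restrictScalars ℝ
    rw [(h1.clm_apply h2).fderiv]
    simp [mul_comm, mul_left_comm, add_comm]
  have hI : ∀ (L : ℂ →L[ℝ] ℂ →L[ℝ] ℝ) (a : ℂ),
      L (a * 1) (a * 1) + L (a * Complex.I) (a * Complex.I) =
        ‖a‖ ^ 2 * (L 1 1 + L Complex.I Complex.I) := by
    intro L a
    have e1 : a * 1 = a.re • (1 : ℂ) + a.im • Complex.I := by
      simp [Complex.re_add_im]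
    have e2 : a * Complex.I = (-a.im) • (1 : ℂ) + a.re • Complex.I := by
      apply Complex.ext <;> simp
    rw [e1, e2, Complex.sq_norm, Complex.normSq_apply]
    simp only [map_add, map_smul, add_apply, smul_apply,
      smul_eq_mul]
    ring
  rw [lap_eq_fderiv_fderiv hu, lap, hsnd, hsnd, ← hI]
  simp only [mul_one, Complex.I_mul_I, mul_neg, map_neg]
  ring

/-- Lemma 5.2: solutions of Liouville's equation transform under
one-to-one holomorphic maps via `u₁ = u₂ ∘ f + log |f'|`. -/
theorem liouville_conformal_invariance (Ω₁ Ω₂ : Set ℂ)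
    (hΩ₁ : IsOpen Ω₁) (hΩ₂ : IsOpen Ω₂)
    (u₂ : ℂ → ℝ) (hreg : ContDiffOn ℝ (⊤ : ℕ∞) u₂ Ω₂)
    (heq : ∀ z ∈ Ω₂, lap u₂ z = Real.exp (2 * u₂ z))
    (f : ℂ → ℂ) (hf : DifferentiableOn ℂ f Ω₁) (hbij : Set.BijOn f Ω₁ Ω₂)
    (u₁ : ℂ → ℝ) (hu₁ : ∀ z : ℂ, u₁ z = u₂ (f z) + Real.log ‖deriv f z‖) :
    ∀ z ∈ Ω₁, lap u₁ z = Real.exp (2 * u₁ z) := by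
  intro z hz
  have hs := hΩ₁.mem_nhds hz
  have hfa : AnalyticAt ℂ f z := hf.analyticAt hs
  have hd : deriv f z ≠ 0 := hfa.deriv_ne_zero_of_injOn hs hbij.injOn
  have hfz : f z ∈ Ω₂ := hbij.mapsTo hz
  have hu : ContDiffAt ℝ 2 u₂ (f z) :=
    (hreg.contDiffAt (hΩ₂.mem_nhds hfz)).of_le (WithTop.coe_le_coe.2 le_top)
  have hlog := hfa.deriv.harmonicAt_log_norm hd
  have hcomp : ContDiffAt ℝ 2 (u₂ ∘ f) z :=
    hu.comp z (hfa.contDiffAt.restrict_scalars ℝ)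
  have hsum : u₁ = (u₂ ∘ f) + fun w => Real.log ‖deriv f w‖ := funext hu₁
  have hadd : ContDiffAt ℝ 2 ((u₂ ∘ f) + fun w => Real.log ‖deriv f w‖) z := hcomp.add hlog.1
  rw [hu₁ z, hsum, lap_eq_laplacian hadd, hcomp.laplacian_add hlog.1,
    hlog.2.self_of_nhds, ← lap_eq_laplacian hcomp, lap_comp_analyticAt hfa hu, heq _ hfz,
    mul_add, Real.exp_add, two_mul (Real.log _), Real.exp_add,
    Real.exp_log (norm_pos_iff.2 hd), Pi.zero_apply]
  ring
end
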